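/- arXiv:1904.05996 — 2 statements merged into one kernel-verified Lean document; each statement's English description precedes it below -/
import Mathlib

section
/- Let S₂ = 𝒪_L⟦X_1,X_2⟧ be the formal power series ring over 𝒪_L in 2n² variables grouped into two n×n matrices of variables X_1, X_2, set X̃_k = I + X_k, and let R' = S₂/J where J is the ideal generated by the n² entries of X̃_2·X̃_1 − X̃_1^{q+1}·X̃_2. Then p is not a zero divisor in R' (so R' is flat over 𝒪_L), the Krull dimension of R' equals n² + 1, and the Krull dimension of R'/(p) equals n². -/
set_option synthInstance.maxHeartbeats 1000000
set_option maxHeartbeats 1000000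

noncomputable section

/-- The ring of integers of `L`: the integral closure of `ℤ_[p]` in `L`. -/
abbrev RingOfIntegers (p : ℕ) [Fact p.Prime] (L : Type*) [Field L] [Algebra ℤ_[p] L] :=
  integralClosure ℤ_[p] L

/-- The matrix of variables `X_k` inside the multivariate power series ring. -/
def varMatrix {A : Type*} [CommRing A] (N n : ℕ) (k : Fin N) :
    Matrix (Fin n) (Fin n) (MvPowerSeries (Fin N × Fin n × Fin n) A) :=
  Matrix.of fun i j => MvPowerSeries.X (k, i, j)

/-- `X̃_k = I + X_k`. -/
def Xt {A : Type*} [CommRing A] (N n : ℕ) (k : Fin N) :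
    Matrix (Fin n) (Fin n) (MvPowerSeries (Fin N × Fin n × Fin n) A) :=
  1 + varMatrix N n k

/-- The ideal of `S₂ = 𝒪⟦X_1, X_2⟧` generated by the `n²` entries of
`X̃_2·X̃_1 − X̃_1^{q+1}·X̃_2`. -/
def helmIdeal (A : Type*) [CommRing A] (q n : ℕ) :
    Ideal (MvPowerSeries (Fin 2 × Fin n × Fin n) A) :=
  Ideal.span (Set.range fun ij : Fin n × Fin n =>
    (Xt (A := A) 2 n 1 * Xt (A := A) 2 n 0 -
      (Xt (A := A) 2 n 0) ^ (q + 1) * Xt (A := A) 2 n 1) ij.1 ij.2)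

/-- `R' = 𝒪⟦X_1, X_2⟧ / (X̃_2·X̃_1 − X̃_1^{q+1}·X̃_2)`: the complete local ring of Helm's
moduli space `M(n, q+1)` at the point `X = Y = I`. -/
abbrev helmLocalRing (A : Type*) [CommRing A] (q n : ℕ) :=
  MvPowerSeries (Fin 2 × Fin n × Fin n) A ⧸ helmIdeal A q n

section CohenMacaulay
open IsLocalRing

variable {S : Type*} [CommRing S]

/-- `x` is a nonzerodivisor modulo the ideal `I`. -/
def RegularMod (I : Ideal S) (x : S) : Prop := ∀ s, x * s ∈ I → s ∈ I

/-- The local ring `S ⧸ I` has a regular sequence of length `r` in its maximal ideal. -/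
def DepthAtLeast [IsLocalRing S] : Ideal S → ℕ → Prop
  | I, 0 => I ≤ maximalIdeal S
  | I, r + 1 => ∃ a ∈ maximalIdeal S, RegularMod I a ∧ DepthAtLeast (I ⊔ Ideal.span {a}) r

lemma mem_sup_span_singleton {I : Ideal S} {a x : S} :
    x ∈ I ⊔ Ideal.span {a} ↔ ∃ u, x - a * u ∈ I := by
  rw [Submodule.mem_sup]
  constructor
  · rintro ⟨y, hy, z, hz, rfl⟩
    obtain ⟨u, rfl⟩ := Ideal.mem_span_singleton'.mp hz
    exact ⟨u, by convert hy using 1; ring⟩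
  · rintro ⟨u, hu⟩
    exact ⟨_, hu, a * u, Ideal.mem_span_singleton'.mpr ⟨u, mul_comm _ _⟩, by ring⟩

lemma RegularMod.swap {I : Ideal S} {a c : S} (ha : RegularMod I a)
    (hc : RegularMod (I ⊔ Ideal.span {a}) c) : RegularMod (I ⊔ Ideal.span {c}) a := by
  intro s hs
  obtain ⟨t, ht⟩ := mem_sup_span_singleton.mp hs
  have h1 : c * t ∈ I ⊔ Ideal.span {a} :=
    mem_sup_span_singleton.mpr ⟨s, by rw [← neg_mem_iff]; convert ht using 1; ring⟩
  obtain ⟨u, hu⟩ := mem_sup_span_singleton.mp (hc t h1)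
  refine mem_sup_span_singleton.mpr ⟨u, ha _ ?_⟩
  convert I.add_mem ht (I.mul_mem_left c hu) using 1
  ring

lemma IsAssociatedPrime.exists_mem_iff_mul_mem [IsNoetherianRing S] {I P : Ideal S}
    (h : IsAssociatedPrime P (S ⧸ I)) : ∃ t, t ∉ I ∧ ∀ y, y ∈ P ↔ y * t ∈ I := by
  obtain ⟨hPp, t', ht'⟩ := isAssociatedPrime_iff.mp h
  obtain ⟨t, rfl⟩ := Ideal.Quotient.mk_surjective t'
  have key : ∀ y, y ∈ P ↔ y * t ∈ I := fun y => by
    rw [ht', Submodule.mem_colon_singleton, Submodule.mem_bot, ← Ideal.Quotient.eq_zero_iff_mem,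
      map_mul, Algebra.smul_def, Ideal.Quotient.algebraMap_eq]
  exact ⟨t, fun ht => hPp.ne_top ((Ideal.eq_top_iff_one _).mpr ((key 1).mpr (by simpa using ht))),
    key⟩

/-- If multiplication by `x` is not injective modulo `I`, then `x` lies in an associated prime. -/
lemma exists_isAssociatedPrime_of_mul_mem [IsNoetherianRing S] {I : Ideal S} {s : S}
    (hs : s ∉ I) : ∃ P : Ideal S, IsAssociatedPrime P (S ⧸ I) ∧ ∀ x, x * s ∈ I → x ∈ P := by
  have hne : (Ideal.Quotient.mk I s) ≠ 0 := by rwa [Ne, Ideal.Quotient.eq_zero_iff_mem]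
  obtain ⟨P, hP, hle⟩ := exists_le_isAssociatedPrime_of_isNoetherianRing S _ hne
  refine ⟨P, hP, fun x hx => hle ?_⟩
  rwa [Submodule.mem_colon_singleton, Submodule.mem_bot, Algebra.smul_def,
    Ideal.Quotient.algebraMap_eq, ← map_mul, Ideal.Quotient.eq_zero_iff_mem]

/-- Prime avoidance: if `m` is not the annihilator of a nonzero element of any `S ⧸ I`, `I ∈ F`,
then there is an element of `m` that is regular modulo every `I ∈ F`. -/
lemma exists_regularMod [IsLocalRing S] [IsNoetherianRing S] (F : Finset (Ideal S))
    (hF : ∀ I ∈ F, ∀ s, (∀ y ∈ maximalIdeal S, y * s ∈ I) → s ∈ I) :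
    ∃ c ∈ maximalIdeal S, ∀ I ∈ F, RegularMod I c := by
  by_contra! hcon
  have hfin : (⋃ I ∈ F, associatedPrimes S (S ⧸ I)).Finite :=
    F.finite_toSet.biUnion fun I _ => associatedPrimes.finite S (S ⧸ I)
  have hprime : ∀ P ∈ ⋃ I ∈ F, associatedPrimes S (S ⧸ I), P.IsPrime := by
    simp only [Set.mem_iUnion]
    rintro P ⟨I, _, hP⟩
    exact hP.1
  obtain ⟨P, hP, hle⟩ := ((maximalIdeal S).subset_union_prime_finite hfin (f := id) ⊥ ⊥
    fun P hP _ _ => hprime P hP).mp (by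
      intro c hc
      obtain ⟨I, hI, hreg⟩ := hcon c hc
      simp only [RegularMod, not_forall] at hreg
      obtain ⟨s, hcs, hs⟩ := hreg
      obtain ⟨P, hP, hmem⟩ := exists_isAssociatedPrime_of_mul_mem hs
      simp only [Set.mem_iUnion]
      exact ⟨P, ⟨I, hI, hP⟩, hmem c hcs⟩)
  simp only [Set.mem_iUnion] at hP
  obtain ⟨I, hI, hP⟩ := hP
  obtain ⟨t, ht, hPt⟩ := IsAssociatedPrime.exists_mem_iff_mul_mem hP
  exact ht (hF I hI t fun y hy => (hPt y).mp (hle hy))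

lemma DepthAtLeast.sup_span_singleton [IsLocalRing S] [IsNoetherianRing S] {r : ℕ} :
    ∀ {I : Ideal S} {x : S}, DepthAtLeast I (r + 1) → x ∈ maximalIdeal S → RegularMod I x →
      DepthAtLeast (I ⊔ Ideal.span {x}) r := by
  induction r with
  | zero =>
    rintro I x ⟨a, ha, -, h⟩ hx -
    exact sup_le (le_sup_left.trans h) (by simpa [Ideal.span_le] using hx)
  | succ r ih =>
    rintro I x ⟨a, ha, hreg, hd⟩ hx hxreg
    obtain ⟨b, hb, hbreg, -⟩ := id hd
    obtain ⟨c, hc, hcF⟩ := exists_regularMod {I, I ⊔ Ideal.span {a}, I ⊔ Ideal.span {x}} (by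
      simp only [Finset.mem_insert, Finset.mem_singleton]
      rintro _ (rfl | rfl | rfl) s hs
      · exact hreg s (hs a ha)
      · exact hbreg s (hs b hb)
      · obtain ⟨t, ht⟩ := mem_sup_span_singleton.mp (hs a ha)
        have ht' : t ∈ I ⊔ Ideal.span {a} := by
          refine hbreg t (mem_sup_span_singleton.mpr ?_)
          obtain ⟨v, hv⟩ := mem_sup_span_singleton.mp (hs b hb)
          refine ⟨v, hxreg _ ?_⟩
          convert I.sub_mem (I.mul_mem_left a hv) (I.mul_mem_left b ht) using 1
          ring
        obtain ⟨u, hu⟩ := mem_sup_span_singleton.mp ht'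
        refine mem_sup_span_singleton.mpr ⟨u, hreg _ ?_⟩
        convert I.add_mem ht (I.mul_mem_left x hu) using 1
        ring)
    have hcI := hcF I (by simp)
    have hca := hcF (I ⊔ Ideal.span {a}) (by simp)
    have hcx := hcF (I ⊔ Ideal.span {x}) (by simp)
    have h1 : DepthAtLeast (I ⊔ Ideal.span {c}) (r + 1) := by
      refine ⟨a, ha, hreg.swap hca, ?_⟩
      rw [sup_right_comm]
      exact ih hd hc hca
    refine ⟨c, hc, hcx, ?_⟩
    rw [sup_right_comm]
    exact ih h1 hx (hxreg.swap hcx)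

lemma DepthAtLeast.le_ringKrullDim_quotient [IsLocalRing S] [IsNoetherianRing S] {r : ℕ} :
    ∀ {I P : Ideal S}, DepthAtLeast I r → IsAssociatedPrime P (S ⧸ I) →
      (r : WithBot ℕ∞) ≤ ringKrullDim (S ⧸ P) := by
  induction r with
  | zero =>
    intro I P _ hP
    have := hP.isPrime
    exact ringKrullDim_nonneg_of_nontrivial
  | succ r ih =>
    rintro I P ⟨a, ha, hreg, hd⟩ hP
    have := hP.isPrime
    obtain ⟨t, ht, hPt⟩ := hP.exists_mem_iff_mul_mem
    -- the submodule of elements killed by `P` is not contained in `a • (S ⧸ I)`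
    obtain ⟨s, hs, hsP⟩ : ∃ s, s ∉ I ⊔ Ideal.span {a} ∧ ∀ y ∈ P, y * s ∈ I := by
      by_contra! hcon
      let N : Ideal S := I.colon (P : Set S)
      have hN : ∀ s, s ∈ N ↔ ∀ y ∈ P, y * s ∈ I := fun s => by
        rw [Submodule.mem_colon]
        exact forall₂_congr fun y _ => by rw [smul_eq_mul, mul_comm]
      have hIN : I ≤ N := fun s hs => (hN s).mpr fun y _ => I.mul_mem_left y hs
      have hle : N ≤ I ⊔ maximalIdeal S • N := by
        intro s hs
        have h1 : s ∈ I ⊔ Ideal.span {a} := by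
          by_contra h
          obtain ⟨y, hy, hys⟩ := hcon s h
          exact hys ((hN s).mp hs y hy)
        obtain ⟨u, hu⟩ := mem_sup_span_singleton.mp h1
        have hu' : u ∈ N := by
          refine (hN u).mpr fun y hy => hreg _ ?_
          convert I.sub_mem ((hN s).mp hs y hy) (I.mul_mem_left y hu) using 1
          ring
        have := Submodule.add_mem_sup hu (Submodule.smul_mem_smul ha hu')
        simpa using this
      have := Submodule.le_of_le_smul_of_le_jacobson_bot (IsNoetherian.noetherian N)
        (IsLocalRing.maximalIdeal_le_jacobson ⊥) hle
      exact ht (this ((hN t).mpr fun y hy => (hPt y).mp hy))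
    obtain ⟨Q, hQ, hmem⟩ := exists_isAssociatedPrime_of_mul_mem hs
    have hPQ : P ≤ Q := fun y hy => hmem y (Ideal.mem_sup_left (hsP y hy))
    have haQ : a ∈ Q := hmem a (mem_sup_span_singleton.mpr ⟨s, by simp⟩)
    have haP : a ∉ P := fun h => ht (hreg t ((hPt a).mp h))
    have h1 := ringKrullDim_succ_le_of_surjective (Ideal.Quotient.factor hPQ)
      (Ideal.Quotient.factor_surjective hPQ) (r := Ideal.Quotient.mk P a)
      (mem_nonZeroDivisors_of_ne_zero (by rwa [Ne, Ideal.Quotient.eq_zero_iff_mem]))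
      (by simpa [Ideal.Quotient.eq_zero_iff_mem] using haQ)
    push_cast
    exact (add_le_add_left (ih hd hQ) 1).trans h1

/-- In a Cohen–Macaulay situation an element which cuts the dimension down is regular. -/
lemma DepthAtLeast.regularMod [IsLocalRing S] [IsNoetherianRing S] {r : ℕ} {I : Ideal S} {x : S}
    (hd : DepthAtLeast I (r + 1)) (h : ringKrullDim (S ⧸ (I ⊔ Ideal.span {x})) ≤ r) :
    RegularMod I x := by
  intro s hs
  by_contra hsI
  obtain ⟨P, hP, hmem⟩ := exists_isAssociatedPrime_of_mul_mem hsI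
  have h1 := hd.le_ringKrullDim_quotient hP
  have hle : I ⊔ Ideal.span {x} ≤ P := sup_le (fun y hy => hmem y (I.mul_mem_right s hy))
    (by simpa [Ideal.span_le] using hmem x hs)
  have h2 := ringKrullDim_le_of_surjective (Ideal.Quotient.factor hle)
    (Ideal.Quotient.factor_surjective hle)
  have h3 := h1.trans (h2.trans h)
  norm_cast at h3
  omega

lemma ringKrullDim_quotient_le_quotient_sup_span_singleton [IsLocalRing S] [IsNoetherianRing S]
    {I : Ideal S} {x : S} (hI : I ≤ maximalIdeal S) (hx : x ∈ maximalIdeal S) :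
    ringKrullDim (S ⧸ I) ≤ ringKrullDim (S ⧸ (I ⊔ Ideal.span {x})) + 1 := by
  have : Nontrivial (S ⧸ I) := Ideal.Quotient.nontrivial_iff.mpr
    fun h => (maximalIdeal.isMaximal S).ne_top (top_le_iff.mp (h ▸ hI))
  have : IsLocalRing (S ⧸ I) := .of_surjective' _ Ideal.Quotient.mk_surjective
  have hx' : Ideal.Quotient.mk I x ∈ Ring.jacobson (S ⧸ I) := by
    rw [IsLocalRing.ringJacobson_eq_maximalIdeal]
    rw [IsLocalRing.mem_maximalIdeal, mem_nonunits_iff]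
    rintro hu
    obtain ⟨y', hy⟩ := hu.exists_right_inv
    obtain ⟨y, rfl⟩ := Ideal.Quotient.mk_surjective y'
    rw [← map_mul, ← map_one (Ideal.Quotient.mk I), Ideal.Quotient.eq] at hy
    have h1 := Ideal.sub_mem _ ((maximalIdeal S).mul_mem_right y hx) (hI hy)
    rw [sub_sub_cancel] at h1
    exact (Ideal.ne_top_iff_one _).mp (maximalIdeal.isMaximal S).ne_top h1
  have h := ringKrullDim_le_ringKrullDim_quotient_add_card {Ideal.Quotient.mk I x}
    (by simpa using hx')
  rw [Finset.coe_singleton, Finset.card_singleton] at h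
  refine h.trans (add_le_add_left (le_of_eq ?_) 1)
  refine ringKrullDim_eq_of_ringEquiv
    ((Ideal.quotEquivOfEq ?_).trans (DoubleQuot.quotQuotEquivQuotSup I (Ideal.span {x})))
  rw [Ideal.map_span, Set.image_singleton]

lemma DepthAtLeast.le_maximalIdeal [IsLocalRing S] {r : ℕ} :
    ∀ {I : Ideal S}, DepthAtLeast I r → I ≤ maximalIdeal S := by
  induction r with
  | zero => exact fun h => h
  | succ r ih => exact fun ⟨a, _, _, h⟩ => le_sup_left.trans (ih h)

lemma ringKrullDim_quotient_le_quotient_sup_span_list [IsLocalRing S] [IsNoetherianRing S]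
    (l : List S) : ∀ {I : Ideal S} {r : ℕ}, I ≤ maximalIdeal S → (∀ x ∈ l, x ∈ maximalIdeal S) →
      ringKrullDim (S ⧸ (I ⊔ Ideal.span {x | x ∈ l})) ≤ r →
      ringKrullDim (S ⧸ I) ≤ (r + l.length : ℕ) := by
  induction l with
  | nil =>
    intro I r _ _ h
    have h0 : I ⊔ Ideal.span {x : S | x ∈ ([] : List S)} = I := by simp
    rwa [h0] at h
  | cons x l ih =>
    intro I r hI hl hdim
    have hsplit : I ⊔ Ideal.span {y | y ∈ x :: l} =
        I ⊔ Ideal.span {x} ⊔ Ideal.span {y | y ∈ l} := by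
      rw [sup_assoc, ← Ideal.span_union]
      congr 2
      ext y
      simp
    rw [hsplit] at hdim
    have hx := hl x (by simp)
    have := ih (sup_le hI (by simpa [Ideal.span_le] using hx)) (fun y hy => hl y (by simp [hy]))
      hdim
    exact (ringKrullDim_quotient_le_quotient_sup_span_singleton hI hx).trans
      ((add_le_add_left this 1).trans (le_of_eq (by push_cast [List.length_cons]; ring)))

/-- A sequence cutting the dimension down by its length keeps the depth maximal. -/
lemma DepthAtLeast.sup_span_list [IsLocalRing S] [IsNoetherianRing S] (l : List S) :
    ∀ {I : Ideal S} {r : ℕ}, DepthAtLeast I (r + l.length) → (∀ x ∈ l, x ∈ maximalIdeal S) →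
      ringKrullDim (S ⧸ (I ⊔ Ideal.span {x | x ∈ l})) ≤ r →
      DepthAtLeast (I ⊔ Ideal.span {x | x ∈ l}) r := by
  induction l with
  | nil => intro I r h _ _; simpa using h
  | cons x l ih =>
    intro I r h hl hdim
    have hsplit : I ⊔ Ideal.span {y | y ∈ x :: l} =
        I ⊔ Ideal.span {x} ⊔ Ideal.span {y | y ∈ l} := by
      rw [sup_assoc, ← Ideal.span_union]
      congr 2
      ext y
      simp
    rw [hsplit] at hdim ⊢
    have hx := hl x (by simp)
    have hl' : ∀ y ∈ l, y ∈ maximalIdeal S := fun y hy => hl y (by simp [hy])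
    have hle : I ⊔ Ideal.span {x} ≤ maximalIdeal S :=
      sup_le h.le_maximalIdeal (by simpa [Ideal.span_le] using hx)
    have h' : DepthAtLeast I (r + l.length + 1) := h
    have hreg := h'.regularMod (ringKrullDim_quotient_le_quotient_sup_span_list l hle hl' hdim)
    exact ih (h'.sup_span_singleton hx hreg) hl' hdim

lemma DepthAtLeast.le_ringKrullDim [IsLocalRing S] [IsNoetherianRing S] {r : ℕ} {I : Ideal S}
    (h : DepthAtLeast I r) : (r : WithBot ℕ∞) ≤ ringKrullDim (S ⧸ I) := by
  have h1 : (1 : S) ∉ I := fun h1 => (Ideal.ne_top_iff_one _).mp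
    (maximalIdeal.isMaximal S).ne_top (h.le_maximalIdeal h1)
  obtain ⟨P, hP, hmem⟩ := exists_isAssociatedPrime_of_mul_mem h1
  have hle : I ≤ P := fun y hy => hmem y (I.mul_mem_right 1 hy)
  exact (h.le_ringKrullDim_quotient hP).trans
    (ringKrullDim_le_of_surjective (Ideal.Quotient.factor hle)
    (Ideal.Quotient.factor_surjective hle))

end CohenMacaulay
section PowerSeriesDepth
open IsLocalRing MvPowerSeries

variable {σ A : Type*} [CommRing A]

lemma MvPowerSeries.mem_span_X_image_iff (T : Finset σ) (f : MvPowerSeries σ A) :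
    f ∈ Ideal.span ((X : σ → MvPowerSeries σ A) '' T) ↔
      ∀ m : σ →₀ ℕ, (∀ i ∈ T, m i = 0) → coeff m f = 0 := by
  classical
  induction T using Finset.induction_on generalizing f with
  | empty =>
    simp only [Finset.coe_empty, Set.image_empty, Ideal.span_empty, Ideal.mem_bot,
      Finset.notMem_empty, false_imp_iff, implies_true, forall_const]
    exact MvPowerSeries.ext_iff
  | insert i T hi ih =>
    rw [Finset.coe_insert, Set.image_insert_eq, Ideal.span_insert, sup_comm,
      mem_sup_span_singleton]
    constructor
    · rintro ⟨u, hu⟩ m hm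
      have h1 := (ih _).mp hu m fun j hj => hm j (Finset.mem_insert_of_mem hj)
      have h2 : coeff m (X i * u) = 0 :=
        (X_dvd_iff.mp (dvd_mul_right (X i) u)) m (hm i (Finset.mem_insert_self _ _))
      rwa [map_sub, h2, sub_zero] at h1
    · intro h
      let g : MvPowerSeries σ A := fun m => if m i = 0 then coeff m f else 0
      have hg : ∀ m, coeff m g = if m i = 0 then coeff m f else 0 := fun m => rfl
      obtain ⟨u, hu⟩ : X i ∣ f - g := X_dvd_iff.mpr fun m hm => by
        rw [map_sub, hg, if_pos hm, sub_self]
      refine ⟨u, ?_⟩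
      rw [← hu, sub_sub_cancel, ih]
      intro m hm
      rw [hg]
      split_ifs with hmi
      · exact h m fun j hj => by
          rcases Finset.mem_insert.mp hj with rfl | hj
          exacts [hmi, hm j hj]
      · rfl

/-- The variables followed by a nonzero nonunit constant form a regular sequence. -/
lemma MvPowerSeries.depthAtLeast_bot [Fintype σ] [IsDomain A] [IsLocalRing A] {a : A} (ha : a ≠ 0)
    (ham : a ∈ maximalIdeal A) :
    DepthAtLeast (⊥ : Ideal (MvPowerSeries σ A)) (Fintype.card σ + 1) := by
  classical
  have hX : ∀ i, (X i : MvPowerSeries σ A) ∈ maximalIdeal _ := fun i => by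
    rw [mem_maximalIdeal, mem_nonunits_iff, isUnit_iff_constantCoeff]
    simp
  have hspan : ∀ T : Finset σ, Ideal.span ((X : σ → MvPowerSeries σ A) '' T) ≤ maximalIdeal _ := by
    intro T
    rw [Ideal.span_le]
    rintro _ ⟨i, -, rfl⟩
    exact hX i
  have key : ∀ U : Finset σ, DepthAtLeast
      (Ideal.span ((X : σ → MvPowerSeries σ A) '' ((Uᶜ : Finset σ) : Set σ))) (U.card + 1) := by
    intro U
    induction U using Finset.induction_on with
    | empty =>
      have haC : C a ∈ maximalIdeal (MvPowerSeries σ A) := by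
        rw [mem_maximalIdeal, mem_nonunits_iff, isUnit_iff_constantCoeff]
        simpa using ham
      refine ⟨C a, haC, fun s hs => ?_, sup_le (hspan _) ?_⟩
      · rw [mem_span_X_image_iff] at hs ⊢
        intro m hm
        simpa [ha] using hs m hm
      · rwa [Ideal.span_singleton_le_iff_mem]
    | insert i U hi ih =>
      rw [Finset.card_insert_of_notMem hi]
      have hUc : Uᶜ = insert i (insert i U)ᶜ := by
        ext j
        by_cases hj : j = i <;> simp [hj, hi]
      refine ⟨X i, hX i, fun s hs => ?_, ?_⟩
      · rw [mem_span_X_image_iff] at hs ⊢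
        intro m hm
        have := hs (m + Finsupp.single i 1) fun j hj => by
          have hji : j ≠ i := by rintro rfl; simp at hj
          simp [hm j hj, hji]
        rwa [add_comm, X_def, coeff_add_monomial_mul, one_mul] at this
      · rwa [sup_comm, ← Ideal.span_union, Set.singleton_union, ← Set.image_insert_eq,
          ← Finset.coe_insert, ← hUc]
  simpa using key Finset.univ

end PowerSeriesDepth

section RationalForm

open Polynomial

/-- A `K[X]`-module has an `F`-rational form if `X` acts on some finite `K`-basis through a matrix
with entries in `F`. -/
def HasRationalForm (F K : Type*) [Field F] [Field K] [Algebra F K] (M : Type*)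
    [AddCommGroup M] [Module K M] [Module K[X] M] : Prop :=
  ∃ (N : ℕ) (b : Module.Basis (Fin N) K M) (c : Fin N → Fin N → F),
    ∀ i, (X : K[X]) • b i = ∑ j, algebraMap F K (c i j) • b j

variable {F K : Type*} [Field F] [Field K] [Algebra F K]

lemma HasRationalForm.of_basis {M : Type*} [AddCommGroup M] [Module K M] [Module K[X] M]
    {ι : Type*} [Fintype ι] (b : Module.Basis ι K M) (c : ι → ι → F)
    (h : ∀ i, (X : K[X]) • b i = ∑ j, algebraMap F K (c i j) • b j) : HasRationalForm F K M := by
  let e := Fintype.equivFin ι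
  refine ⟨Fintype.card ι, b.reindex e, fun i j => c (e.symm i) (e.symm j), fun i => ?_⟩
  simp only [Module.Basis.reindex_apply]
  rw [h, ← e.symm.sum_comp]

lemma HasRationalForm.of_linearEquiv {M N : Type*}
    [AddCommGroup M] [Module K M] [Module K[X] M] [IsScalarTower K K[X] M]
    [AddCommGroup N] [Module K N] [Module K[X] N] [IsScalarTower K K[X] N]
    (f : M ≃ₗ[K[X]] N) (h : HasRationalForm F K M) : HasRationalForm F K N := by
  obtain ⟨n, b, c, h⟩ := h
  refine ⟨n, b.map (f.restrictScalars K), c, fun i => ?_⟩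
  have := congrArg (f.restrictScalars K) (h i)
  simpa using this

lemma hasRationalForm_quotient_span {g : F[X]} (hg : g.Monic) :
    HasRationalForm F K (K[X] ⧸ Ideal.span {g.map (algebraMap F K)}) := by
  have hg' := hg.map (algebraMap F K)
  let b : Module.Basis _ K (K[X] ⧸ Ideal.span {g.map (algebraMap F K)}) :=
    AdjoinRoot.powerBasisAux' hg'
  refine .of_basis b (fun i j => ((X ^ ((i : ℕ) + 1)) %ₘ g).coeff j) fun i => ?_
  have hb : b i = AdjoinRoot.mk (g.map (algebraMap F K)) (X ^ (i : ℕ)) := by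
    rw [map_pow]
    exact (AdjoinRoot.powerBasis' hg').basis_eq_pow i
  have h1 : (X : K[X]) • b i = AdjoinRoot.mk (g.map (algebraMap F K)) (X ^ ((i : ℕ) + 1)) := by
    rw [hb, pow_succ', map_mul]
    rfl
  rw [h1, ← b.sum_repr (AdjoinRoot.mk (g.map (algebraMap F K)) (X ^ ((i : ℕ) + 1)))]
  refine Finset.sum_congr rfl fun j _ => ?_
  congr 1
  refine (AdjoinRoot.powerBasisAux'_repr_apply_to_fun hg' _ j).trans ?_
  rw [AdjoinRoot.modByMonicHom_mk, ← coeff_map, map_modByMonic _ hg]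
  simp

lemma HasRationalForm.pi {ι : Type*} [Fintype ι] (M : ι → Type*)
    [∀ i, AddCommGroup (M i)] [∀ i, Module K (M i)] [∀ i, Module K[X] (M i)]
    (h : ∀ i, HasRationalForm F K (M i)) : HasRationalForm F K (∀ i, M i) := by
  classical
  choose κ b c h using h
  refine .of_basis (Pi.basis b)
    (fun x y => if hxy : x.1 = y.1 then c y.1 (hxy ▸ x.2) y.2 else 0) ?_
  rintro ⟨i, j⟩
  rw [Fintype.sum_sigma, Finset.sum_eq_single i]
  · simp only [Pi.basis_apply, dite_true, ← Pi.single_smul, h]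
    exact map_sum (AddMonoidHom.single M i) _ _
  · intro i' _ hi'
    refine Finset.sum_eq_zero fun k _ => ?_
    simp [Ne.symm hi']
  · simp

lemma hasRationalForm_aeval [IsAlgClosed K] {V : Type*} [AddCommGroup V] [Module K V]
    [FiniteDimensional K V] (f : Module.End K V)
    (hf : ∀ μ, f.HasEigenvalue μ → μ ∈ (algebraMap F K).range) :
    HasRationalForm F K (Module.AEval' f) := by
  obtain ⟨ι, _, p, hp, e, ⟨E⟩⟩ := Module.equiv_directSum_of_isTorsion
    (Module.AEval.isTorsion_of_finiteDimensional K V f)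
  classical
  let E' := E.trans (DirectSum.linearEquivFunOnFintype K[X] ι _)
  refine .of_linearEquiv E'.symm (.pi _ fun i => ?_)
  suffices h : ∃ g : F[X], g.Monic ∧ Associated (g.map (algebraMap F K)) (p i ^ e i) by
    obtain ⟨g, hg, h⟩ := h
    have h' : Ideal.span {g.map (algebraMap F K)} = Ideal.span {p i ^ e i} :=
      Ideal.span_singleton_eq_span_singleton.mpr h
    exact .of_linearEquiv (Submodule.quotEquivOfEq _ _ h') (hasRationalForm_quotient_span hg)
  rcases Nat.eq_zero_or_pos (e i) with h0 | h0
  · exact ⟨1, monic_one, by simp [h0]⟩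
  obtain ⟨μ, hμ⟩ := IsAlgClosed.exists_root (p i)
    (degree_pos_of_irreducible (hp i)).ne'
  have hass : Associated (X - C μ) (p i) :=
    (irreducible_X_sub_C μ).associated_of_dvd (hp i) (dvd_iff_isRoot.mpr hμ)
  have hdvd : p i ∣ minpoly K f := by
    refine (dvd_pow_self _ h0.ne').trans ?_
    have h1 : minpoly K f • (E'.symm (Pi.single i (Submodule.Quotient.mk 1))) = 0 := by
      apply (Module.AEval.of K V f).symm.injective
      rw [Module.AEval.of_symm_smul]
      simp
    rw [← map_smul, LinearEquiv.map_eq_zero_iff, ← Pi.single_smul, Pi.single_eq_zero_iff,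
      ← Submodule.Quotient.mk_smul, Submodule.Quotient.mk_eq_zero, smul_eq_mul, mul_one] at h1
    exact Ideal.mem_span_singleton.mp h1
  obtain ⟨l, hl⟩ := hf μ (Module.End.hasEigenvalue_of_isRoot (hμ.dvd hdvd))
  refine ⟨(X - C l) ^ e i, (monic_X_sub_C l).pow _, ?_⟩
  simpa [hl] using hass.pow_pow

lemma Matrix.exists_rational_form [IsAlgClosed K] {n : ℕ} (Y : Matrix (Fin n) (Fin n) K)
    (hY : ∀ μ, μ ∈ spectrum K Y → μ ∈ (algebraMap F K).range) :
    ∃ (g : Matrix (Fin n) (Fin n) K) (J : Matrix (Fin n) (Fin n) F),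
      IsUnit g ∧ Y * g = g * J.map (algebraMap F K) := by
  obtain ⟨N, b, c, h⟩ := hasRationalForm_aeval (F := F) (Matrix.toLin' Y) fun μ hμ => hY μ <| by
    rw [Module.End.hasEigenvalue_iff_mem_spectrum, Matrix.spectrum_toLin'] at hμ
    exact hμ
  let b' := b.map (Module.AEval'.of (Matrix.toLin' Y)).symm
  have hN : N = n := by
    simpa using (Module.finrank_eq_card_basis b').symm
  subst hN
  have h' (i) : Y.mulVec (b' i) = ∑ j, algebraMap F K (c i j) • b' j := by
    have := congrArg (Module.AEval'.of (Matrix.toLin' Y)).symm (h i)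
    rw [Module.AEval'.of_symm_X_smul, map_sum] at this
    simpa [b'] using this
  refine ⟨(Pi.basisFun K _).toMatrix b', (Matrix.of c).transpose, ?_, ?_⟩
  · have := (Pi.basisFun K (Fin N)).invertibleToMatrix b'
    exact isUnit_of_invertible _
  · ext i j
    have := congrFun (h' j) i
    simp only [Matrix.mul_apply, Module.Basis.toMatrix_apply, Pi.basisFun_repr]
    simp only [Matrix.mulVec, dotProduct, Finset.sum_apply, Pi.smul_apply] at this
    rw [this]
    exact Finset.sum_congr rfl fun k _ => by simp [mul_comm]

end RationalForm

section Intertwiner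

variable {F K : Type*} [Field F] [Field K] [Algebra F K]

lemma exists_finset_bijective_of_dual {ι V : Type*} [Finite ι] [AddCommGroup V] [Module K V]
    [FiniteDimensional K V] (p : ι → Module.Dual K V) (hp : ∀ v, (∀ i, p i v = 0) → v = 0) :
    ∃ T : Finset ι, Function.Bijective (LinearMap.pi fun i : T => p i) := by
  classical
  have hspan : Submodule.span K (Set.range p) = ⊤ := by
    rw [← Subspace.dualCoannihilator_dualAnnihilator_eq (W := Submodule.span K (Set.range p))]
    have h0 : (Submodule.span K (Set.range p)).dualCoannihilator = ⊥ := by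
      refine (Submodule.eq_bot_iff _).mpr fun v hv => ?_
      rw [Submodule.mem_dualCoannihilator] at hv
      exact hp v fun i => hv _ (Submodule.subset_span ⟨i, rfl⟩)
    rw [h0, Submodule.dualAnnihilator_bot]
  obtain ⟨κ, a, ha, h1, h2⟩ := exists_linearIndependent' K p
  have : Fintype κ := @Fintype.ofFinite _ (Finite.of_injective a ha)
  let T := Finset.univ.map ⟨a, ha⟩
  have hinj : Function.Injective (LinearMap.pi fun i : T => p i) := by
    rw [← LinearMap.ker_eq_bot, Submodule.eq_bot_iff]
    intro v hv
    have h3 (j : κ) : p (a j) v = 0 :=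
      congrFun (LinearMap.mem_ker.mp hv) ⟨a j, by simp [T]⟩
    have h4 : ∀ f ∈ Submodule.span K (Set.range (p ∘ a)), f v = 0 := by
      intro f hf
      induction hf using Submodule.span_induction with
      | mem x hx => obtain ⟨j, rfl⟩ := hx; exact h3 j
      | zero => rfl
      | add x y _ _ hx hy => simp [hx, hy]
      | smul c x _ hx => simp [hx]
    exact hp v fun i => h4 _ (by rw [h1, hspan]; trivial)
  have hcard : Module.finrank K V = Module.finrank K (T → K) := by
    rw [Module.finrank_fintype_fun_eq_card, Fintype.card_coe, Finset.card_map, Finset.card_univ,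
      ← finrank_span_eq_card h2, h1, hspan, finrank_top, Subspace.dual_finrank_eq]
  exact ⟨T, hinj, (LinearMap.injective_iff_surjective_of_finrank_eq_finrank hcard).mp hinj⟩

variable {n : Type*} [Fintype n]

/-- The space of matrices `h` with `h * A = B * h`. -/
def Matrix.intertwiners (A B : Matrix n n K) : Submodule K (Matrix n n K) where
  carrier := {h | h * A = B * h}
  add_mem' := by
    intro x y (hx : _ = _) (hy : _ = _)
    simp [add_mul, mul_add, hx, hy]
  zero_mem' := by simp
  smul_mem' := by
    intro c x (hx : _ = _)
    simp [hx]

lemma Matrix.mem_intertwiners {A B h : Matrix n n K} :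
    h ∈ Matrix.intertwiners A B ↔ h * A = B * h := Iff.rfl

/-- The matrix entries as functionals on a space of matrices. -/
def Matrix.entryDual (W : Submodule K (Matrix n n K)) (ij : n × n) : Module.Dual K W :=
  (Matrix.entryLinearMap K K ij.1 ij.2).comp W.subtype

lemma Matrix.exists_finset_bijective_entryDual (W : Submodule K (Matrix n n K)) :
    ∃ T : Finset (n × n), Function.Bijective (LinearMap.pi fun i : T => Matrix.entryDual W i) :=
  exists_finset_bijective_of_dual _ fun v hv => by
    ext i j
    exact hv (i, j)

/-- An intertwiner between `F`-rational matrices is `F`-rational in terms of any set of entries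
which determine intertwiners. -/
lemma Matrix.mem_span_of_mem_intertwiners {A B : Matrix n n F} {T : Finset (n × n)}
    (hT : ∀ h ∈ Matrix.intertwiners (A.map (algebraMap F K)) (B.map (algebraMap F K)),
      (∀ t ∈ T, h t.1 t.2 = 0) → h = 0)
    {z : Matrix n n K}
    (hz : z ∈ Matrix.intertwiners (A.map (algebraMap F K)) (B.map (algebraMap F K))) (i j : n) :
    z i j ∈ Submodule.span F ((fun t : n × n => z t.1 t.2) '' T) := by
  by_contra hij
  obtain ⟨ψ, hψ, hle⟩ := Submodule.exists_le_ker_of_notMem hij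
  refine hψ ?_
  rw [Matrix.mem_intertwiners] at hz
  have hmem : (z.map ψ) * A = B * z.map ψ := by
    ext a b
    have := congrArg ψ (congrFun (congrFun hz a) b)
    simp only [Matrix.mul_apply, Matrix.map_apply, map_sum] at this ⊢
    simp only [mul_comm (z _ _), ← Algebra.smul_def, map_smul, smul_eq_mul] at this
    simpa only [mul_comm] using this
  have h0 := hT ((z.map ψ).map (algebraMap F K)) (by
    rw [Matrix.mem_intertwiners, ← Matrix.map_mul, hmem, Matrix.map_mul]) (by
    intro t ht
    have : z t.1 t.2 ∈ LinearMap.ker ψ := hle (Submodule.subset_span ⟨t, ht, rfl⟩)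
    simp [LinearMap.mem_ker.mp this])
  simpa using congrFun (congrFun h0 i) j

lemma Matrix.exists_map_eq_of_mem {E : IntermediateField F K} {n : Type*} {M : Matrix n n K}
    (hM : ∀ i j, M i j ∈ E) : ∃ M' : Matrix n n E, M'.map (algebraMap E K) = M :=
  ⟨Matrix.of fun i j => ⟨M i j, hM i j⟩, rfl⟩

lemma Matrix.mul_apply_mem {E : IntermediateField F K} {M N : Matrix n n K}
    (hM : ∀ i j, M i j ∈ E) (hN : ∀ i j, N i j ∈ E) (i j : n) : (M * N) i j ∈ E :=
  sum_mem fun k _ => mul_mem (hM i k) (hN k j)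

variable [DecidableEq n]

/-- A space of matrices containing an invertible matrix contains one with prescribed rational
coordinates. -/
lemma Matrix.exists_isUnit_mem_of_bijective [Infinite F] {W : Submodule K (Matrix n n K)}
    {T : Finset (n × n)}
    (hT : Function.Bijective (LinearMap.pi fun i : T => Matrix.entryDual W i))
    {g : Matrix n n K} (hg : g ∈ W) (hgu : IsUnit g) :
    ∃ g' ∈ W, IsUnit g' ∧ ∀ t ∈ T, g' t.1 t.2 ∈ (algebraMap F K).range := by
  classical
  let e := LinearEquiv.ofBijective _ hT
  let M : Matrix n n (MvPolynomial T K) := Matrix.of fun i j =>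
    ∑ t, MvPolynomial.C ((e.symm (Pi.single t 1)).1 i j) * MvPolynomial.X t
  have hM (x : T → K) : MvPolynomial.eval x M.det = (e.symm x).1.det := by
    rw [RingHom.map_det]
    congr 1
    ext i j
    have h1 : e.symm x = ∑ t, x t • e.symm (Pi.single t 1) := by
      conv_lhs => rw [pi_eq_sum_univ' x]
      simp only [map_sum, map_smul, Pi.single]
    rw [h1]
    simp [M, Matrix.sum_apply, mul_comm]
  by_contra! hne
  have h0 : M.det = 0 := by
    refine MvPolynomial.funext_set (s := fun _ => Set.range (algebraMap F K))
      (fun _ => Set.infinite_range_of_injective (algebraMap F K).injective) fun x hx => ?_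
    rw [hM, map_zero]
    by_contra hdet
    obtain ⟨t, ht, h⟩ := hne _ (e.symm x).2
      ((Matrix.isUnit_iff_isUnit_det _).mpr (isUnit_iff_ne_zero.mpr hdet))
    refine h ?_
    have h2 : (e.symm x).1 t.1 t.2 = x ⟨t, ht⟩ := congrFun (e.apply_symm_apply x) ⟨t, ht⟩
    rw [h2]
    exact hx ⟨t, ht⟩ trivial
  have h1 := hM (e ⟨g, hg⟩)
  rw [h0, map_zero, e.symm_apply_apply] at h1
  exact ((Matrix.isUnit_iff_isUnit_det _).mp hgu).ne_zero h1.symm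

lemma Matrix.inv_apply_mem {E : IntermediateField F K} {M : Matrix n n K}
    (hM : ∀ i j, M i j ∈ E) (i j : n) : M⁻¹ i j ∈ E := by
  obtain ⟨M', rfl⟩ := Matrix.exists_map_eq_of_mem hM
  rw [← RingHom.mapMatrix_apply, Matrix.inv_def, ← RingHom.map_det, ← RingHom.map_adjugate,
    Ring.inverse_eq_inv, Matrix.smul_apply, smul_eq_mul]
  exact mul_mem (inv_mem (M'.det).2) (M'.adjugate i j).2

lemma Matrix.exists_finset_forall_mem_adjoin [Infinite F] {X Y g : Matrix n n K} {J : Matrix n n F}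
    {m : ℕ} (hX : IsUnit X) (hg : IsUnit g) (hXY : X * Y = Y ^ m * X)
    (hYg : Y * g = g * J.map (algebraMap F K)) :
    ∃ T : Finset K, T.card ≤ Fintype.card n ^ 2 ∧
      ∀ i j, X i j ∈ IntermediateField.adjoin F (T : Set K) ∧
        Y i j ∈ IntermediateField.adjoin F (T : Set K) := by
  classical
  set JK := J.map (algebraMap F K) with hJK
  have hJm : (J ^ m).map (algebraMap F K) = JK ^ m := by
    rw [hJK, ← RingHom.mapMatrix_apply, map_pow, RingHom.mapMatrix_apply]
  have hpow {g : Matrix n n K} (h : Y * g = g * JK) : Y ^ m * g = g * JK ^ m := by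
    have : SemiconjBy g JK Y := h.symm
    exact (this.pow_right m).symm
  let W := Matrix.intertwiners JK Y
  let U := Matrix.intertwiners JK (JK ^ m)
  have hUW : Module.finrank K U ≤ Module.finrank K W := by
    let f : U →ₗ[K] W := LinearMap.restrict (LinearMap.mulLeft K (X⁻¹ * g)) fun h hh => by
      have hh' : h * JK = JK ^ m * h := hh
      have hY' : Y * X⁻¹ = X⁻¹ * Y ^ m := by
        rw [← hX.mul_right_inj, ← hX.mul_left_inj]
        have h1 := (Matrix.isUnit_iff_isUnit_det _).mp hX
        simp only [mul_assoc, Matrix.nonsing_inv_mul X h1, mul_one]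
        simp only [← mul_assoc, Matrix.mul_nonsing_inv X h1, one_mul, hXY]
      change X⁻¹ * g * h * JK = Y * (X⁻¹ * g * h)
      rw [mul_assoc, hh', ← mul_assoc Y, ← mul_assoc Y, hY', mul_assoc X⁻¹ (Y ^ m), hpow hYg]
      simp only [mul_assoc]
    refine LinearMap.finrank_le_finrank_of_injective (f := f) fun a b hab => ?_
    have h1 : IsUnit (X⁻¹ * g) := (Matrix.isUnit_nonsing_inv_iff.mpr hX).mul hg
    exact Subtype.ext (h1.mul_right_injective (congrArg Subtype.val hab))
  obtain ⟨TW, hTW⟩ := Matrix.exists_finset_bijective_entryDual W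
  obtain ⟨TU, hTU⟩ := Matrix.exists_finset_bijective_entryDual U
  have hcW : TW.card = Module.finrank K W := by
    simpa using (LinearEquiv.ofBijective _ hTW).finrank_eq.symm
  have hcU : TU.card = Module.finrank K U := by
    simpa using (LinearEquiv.ofBijective _ hTU).finrank_eq.symm
  obtain ⟨h, hhW, hhu, hh⟩ :=
    Matrix.exists_isUnit_mem_of_bijective (F := F) hTW (g := g) hYg.symm hg
  replace hhW : h * JK = Y * h := hhW
  have hhdet := (Matrix.isUnit_iff_isUnit_det _).mp hhu
  have hYh : Y = h * JK * h⁻¹ := by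
    rw [hhW, mul_assoc, Matrix.mul_nonsing_inv h hhdet, mul_one]
  set Z := h⁻¹ * X * h with hZ
  have hXZ : X = h * Z * h⁻¹ := by
    simp only [hZ, mul_assoc, Matrix.mul_nonsing_inv h hhdet, mul_one]
    rw [← mul_assoc, Matrix.mul_nonsing_inv h hhdet, one_mul]
  have hZU : Z ∈ Matrix.intertwiners JK (JK ^ m) := by
    rw [Matrix.mem_intertwiners, hZ, mul_assoc, hhW, mul_assoc h⁻¹, ← mul_assoc X, hXY,
      ← mul_assoc (JK ^ m), ← mul_assoc (JK ^ m)]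
    have : JK ^ m * h⁻¹ = h⁻¹ * Y ^ m := by
      rw [← hhu.mul_right_inj, ← hhu.mul_left_inj]
      simp only [mul_assoc, Matrix.nonsing_inv_mul h hhdet, mul_one]
      rw [← hpow hhW.symm, ← mul_assoc h, Matrix.mul_nonsing_inv h hhdet, one_mul]
    rw [this]
    simp only [mul_assoc]
  let T1 : Finset K := TWᶜ.image fun t => h t.1 t.2
  let T2 : Finset K := TU.image fun t => Z t.1 t.2
  have hcard : (T1 ∪ T2).card ≤ Fintype.card n ^ 2 := by
    refine (Finset.card_union_le _ _).trans ?_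
    have h1 : T1.card ≤ _ := Finset.card_image_le
    have h2 : T2.card ≤ _ := Finset.card_image_le
    have h3 := TW.card_add_card_compl
    rw [Fintype.card_prod, ← sq] at h3
    lia
  refine ⟨T1 ∪ T2, hcard, ?_⟩
  set E := IntermediateField.adjoin F ((T1 ∪ T2 : Finset K) : Set K)
  have hTE {x : K} (hx : x ∈ T1 ∪ T2) : x ∈ E := IntermediateField.subset_adjoin F _ hx
  have hhE (i j) : h i j ∈ E := by
    by_cases ht : (i, j) ∈ TW
    · obtain ⟨a, ha⟩ := hh _ ht
      exact ha ▸ E.algebraMap_mem a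
    · exact hTE (Finset.mem_union_left _ (Finset.mem_image.mpr ⟨(i, j), by simpa using ht, rfl⟩))
  have hZE (i j) : Z i j ∈ E := by
    rw [← hJm] at hZU
    have h1 := Matrix.mem_span_of_mem_intertwiners (T := TU) (fun a ha ha0 => ?_) hZU i j
    · refine (Submodule.span_le (p := E.toSubalgebra.toSubmodule)).mpr ?_ h1
      rintro _ ⟨t, ht, rfl⟩
      exact hTE (Finset.mem_union_right _ (Finset.mem_image.mpr ⟨t, ht, rfl⟩))
    · rw [hJm] at ha
      have h2 : (⟨a, ha⟩ : U) = 0 := hTU.1 (by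
        ext t
        exact ha0 t t.2)
      exact congrArg Subtype.val h2
  have hJE (i j) : JK i j ∈ E := E.algebraMap_mem _
  intro i j
  rw [hXZ, hYh]
  exact ⟨Matrix.mul_apply_mem (Matrix.mul_apply_mem hhE hZE) (Matrix.inv_apply_mem hhE) i j,
    Matrix.mul_apply_mem (Matrix.mul_apply_mem hhE hJE) (Matrix.inv_apply_mem hhE) i j⟩

end Intertwiner

section TranscendenceDegree

lemma isAlgebraic_adjoin_of_mem_adjoin_algebraicClosure {k K : Type*} [Field k] [Field K]
    [Algebra k K] {T : Set K} {x : K}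
    (hx : x ∈ IntermediateField.adjoin (algebraicClosure k K) T) :
    IsAlgebraic (Algebra.adjoin k T) x := by
  induction hx using IntermediateField.adjoin_induction with
  | mem x hx => exact isAlgebraic_algebraMap (⟨x, Algebra.subset_adjoin hx⟩ : Algebra.adjoin k T)
  | algebraMap x =>
    have h : IsAlgebraic k (algebraMap (algebraicClosure k K) K x) :=
      mem_algebraicClosure_iff.mp x.2
    exact h.extendScalars (FaithfulSMul.algebraMap_injective k (Algebra.adjoin k T))
  | add x y _ _ hx hy => exact hx.add hy
  | inv x _ hx => exact hx.inv
  | mul x y _ _ hx hy => exact hx.mul hy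

lemma AlgebraicIndependent.card_le_of_isAlgebraic_adjoin {k K : Type*} [Field k] [Field K]
    [Algebra k K] {s : ℕ} {x : Fin s → K} (hx : AlgebraicIndependent k x) (T : Finset K)
    (h : ∀ i, IsAlgebraic (Algebra.adjoin k (T : Set K)) (x i)) : s ≤ T.card := by
  have h1 : (AlgebraicIndependent.matroid k K).Indep (Set.range x) :=
    AlgebraicIndependent.matroid_indep_iff.mpr hx.coe_range
  have h2 : Set.range x ⊆ (AlgebraicIndependent.matroid k K).closure T := by
    rw [AlgebraicIndependent.matroid_closure_eq]
    rintro _ ⟨i, rfl⟩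
    exact h i
  have h3 := (h1.encard_le_eRk_of_subset h2).trans
    (((AlgebraicIndependent.matroid k K).eRk_closure_eq _).trans_le
      ((AlgebraicIndependent.matroid k K).eRk_le_encard _))
  rw [Set.encard_coe_eq_coe_finsetCard, ← Set.image_univ, hx.injective.encard_image] at h3
  simpa using h3

lemma ringKrullDim_le_of_isIntegral {R S : Type*} [CommRing R] [CommRing S] (f : R →+* S)
    (hf : f.IsIntegral) : ringKrullDim S ≤ ringKrullDim R := by
  algebraize [f]
  refine Order.krullDim_le_of_strictMono (PrimeSpectrum.comap f) fun P Q hPQ => ?_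
  obtain ⟨x, hxQ, hxP⟩ := SetLike.exists_of_lt (show P.asIdeal < Q.asIdeal from hPQ)
  exact Ideal.comap_lt_comap_of_integral_mem_sdiff (show P.asIdeal ≤ Q.asIdeal from hPQ.le)
    ⟨hxQ, hxP⟩ (hf x)

/-- If `X * Y = Y ^ m * X` with `X` invertible, the eigenvalues of `Y` are stable under `m`-th
powers, hence roots of unity or zero. -/
lemma Matrix.isAlgebraic_of_mem_spectrum {k K n : Type*} [Field k] [Field K] [Algebra k K]
    [Fintype n] [DecidableEq n] {X Y : Matrix n n K} {m : ℕ} (hm : 2 ≤ m) (hX : IsUnit X)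
    (hXY : X * Y = Y ^ m * X) {μ : K} (hμ : μ ∈ spectrum K Y) : IsAlgebraic k μ := by
  have hstep {ν : K} (hν : ν ∈ spectrum K Y) : ν ^ m ∈ spectrum K Y := by
    have h1 : Y ^ m = hX.unit * Y * (hX.unit⁻¹ : (Matrix n n K)ˣ) := by
      rw [IsUnit.unit_spec, hXY, mul_assoc, IsUnit.mul_val_inv, mul_one]
    have h2 := spectrum.pow_mem_pow Y m hν
    rwa [h1, spectrum.units_conjugate] at h2
  have hiter (r : ℕ) : μ ^ m ^ r ∈ spectrum K Y := by
    induction r with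
    | zero => simpa using hμ
    | succ r ih => simpa [pow_succ, pow_mul] using hstep ih
  obtain ⟨a, b, hab, h⟩ := Set.Finite.exists_lt_map_eq_of_forall_mem hiter
    (Matrix.finite_spectrum Y)
  refine ⟨Polynomial.X ^ m ^ b - Polynomial.X ^ m ^ a, ?_, by simp [h]⟩
  have hlt : m ^ a < m ^ b := Nat.pow_lt_pow_right (by lia) hab
  rw [sub_ne_zero]
  intro he
  have := congrArg Polynomial.natDegree he
  simp at this
  exact absurd (Nat.pow_right_injective hm this) hab.ne'

lemma ringKrullDim_le_sq_card_of_mul_eq_pow_mul {k D : Type*} [Field k] [CommRing D] [IsDomain D]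
    [Algebra k D] {n : ℕ} {X Y : Matrix (Fin n) (Fin n) D} {m : ℕ} (hm : 2 ≤ m)
    (hX : X.det ≠ 0) (hXY : X * Y = Y ^ m * X)
    (htop : Algebra.adjoin k
      (Set.range (fun ij : Fin n × Fin n => X ij.1 ij.2) ∪
        Set.range fun ij : Fin n × Fin n => Y ij.1 ij.2) = ⊤) :
    ringKrullDim D ≤ (n ^ 2 : ℕ) := by
  classical
  have : Algebra.FiniteType k D :=
    ⟨⟨((Set.finite_range _).union (Set.finite_range _)).toFinset, by simpa using htop⟩⟩
  obtain ⟨s, g, hginj, hgint⟩ := exists_integral_inj_algHom_of_fg k D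
  have hdim : ringKrullDim D ≤ s := by
    refine (ringKrullDim_le_of_isIntegral g.toRingHom hgint).trans ?_
    rw [MvPolynomial.ringKrullDim_of_isNoetherianRing]
    simp
  refine hdim.trans ?_
  let K := AlgebraicClosure (FractionRing D)
  let F := algebraicClosure k K
  have hDK : Function.Injective (algebraMap D K) := by
    rw [IsScalarTower.algebraMap_eq D (FractionRing D) K]
    exact (algebraMap (FractionRing D) K).injective.comp (IsFractionRing.injective D _)
  let φ : D →ₐ[k] K := IsScalarTower.toAlgHom k D K
  have : IsAlgClosed F := IsAlgClosure.isAlgClosed k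
  have : Infinite F := IsAlgClosed.instInfinite
  let XK := φ.mapMatrix X
  let YK := φ.mapMatrix Y
  have hXK : IsUnit XK := by
    rw [Matrix.isUnit_iff_isUnit_det, isUnit_iff_ne_zero]
    change (φ.mapMatrix X).det ≠ 0
    rw [← AlgHom.map_det]
    exact (map_ne_zero_iff _ hDK).mpr hX
  have hXYK : XK * YK = YK ^ m * XK := by
    simp only [XK, YK, ← map_mul, ← map_pow, hXY]
  obtain ⟨h, J, hh, hJ⟩ := Matrix.exists_rational_form (F := F) YK fun μ hμ =>
    ⟨⟨μ, mem_algebraicClosure_iff.mpr (Matrix.isAlgebraic_of_mem_spectrum hm hXK hXYK hμ)⟩, rfl⟩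
  obtain ⟨T, hT, hmem⟩ := Matrix.exists_finset_forall_mem_adjoin hXK hh hXYK hJ
  rw [Fintype.card_fin] at hT
  let E := IntermediateField.adjoin F (T : Set K)
  have hφ (d : D) : φ d ∈ E := by
    have hd : d ∈ Algebra.adjoin k (Set.range (fun ij : Fin n × Fin n => X ij.1 ij.2) ∪
        Set.range fun ij : Fin n × Fin n => Y ij.1 ij.2) := htop ▸ Algebra.mem_top
    have hle : Algebra.adjoin k (Set.range (fun ij : Fin n × Fin n => X ij.1 ij.2) ∪
        Set.range fun ij : Fin n × Fin n => Y ij.1 ij.2) ≤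
          (E.toSubalgebra.restrictScalars k).comap φ := by
      rw [Algebra.adjoin_le_iff]
      rintro _ (⟨ij, rfl⟩ | ⟨ij, rfl⟩)
      · exact (hmem ij.1 ij.2).1
      · exact (hmem ij.1 ij.2).2
    exact hle hd
  have hx : AlgebraicIndependent k fun i => (φ.comp g) (MvPolynomial.X i) :=
    (MvPolynomial.algebraicIndependent_X (Fin s) k).map' (hDK.comp hginj)
  have := (hx.card_le_of_isAlgebraic_adjoin T fun i =>
    isAlgebraic_adjoin_of_mem_adjoin_algebraicClosure (hφ _)).trans hT
  exact_mod_cast this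

end TranscendenceDegree

section Transfer

open IsLocalRing

lemma Ideal.height_le_of_forall_ringKrullDim_quotient_le {R : Type*} [CommRing R] {𝔪 : Ideal R}
    [𝔪.IsPrime] {d : ℕ} (h : ∀ P : Ideal R, P.IsPrime → P ≤ 𝔪 → ringKrullDim (R ⧸ P) ≤ d) :
    𝔪.height ≤ d := by
  change (⟨𝔪, ‹𝔪.IsPrime›⟩ : PrimeSpectrum R).asIdeal.height ≤ d
  rw [PrimeSpectrum.height_eq_orderHeight]
  refine Order.height_le fun l hl => ?_
  have hle (i) : l.head ≤ l i := l.monotone (Fin.zero_le i)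
  let l' : LTSeries (PrimeSpectrum.zeroLocus (l.head.asIdeal : Set R)) :=
    { length := l.length
      toFun := fun i => ⟨l i, hle i⟩
      step := fun i => l.step i }
  have h1 := h l.head.asIdeal l.head.2 (by
    have := hle (Fin.last _)
    rw [← RelSeries.last, hl] at this
    exact this)
  rw [ringKrullDim_quotient] at h1
  exact_mod_cast (Order.LTSeries.length_le_krullDim l').trans h1

/-- Compares the quotient of a local ring `S` by an extended ideal with the finite type situation:
`S` plays the role of a completion of `R` at `𝔪`. -/
lemma ringKrullDim_quotient_map_le {R S : Type*} [CommRing R] [IsNoetherianRing R] [CommRing S]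
    [IsLocalRing S] [IsNoetherianRing S] (f : R →+* S) {J 𝔪 : Ideal R} [𝔪.IsPrime] (hJ : J ≤ 𝔪)
    (hcomap : (maximalIdeal S).comap f = 𝔪) (hmap : maximalIdeal S ≤ 𝔪.map f) {d : ℕ}
    (h : ∀ P : Ideal R, P.IsPrime → J ≤ P → P ≤ 𝔪 → ringKrullDim (R ⧸ P) ≤ d) :
    ringKrullDim (S ⧸ J.map f) ≤ d := by
  classical
  let π := Ideal.Quotient.mk J
  have hπ : Function.Surjective π := Ideal.Quotient.mk_surjective
  have hker : RingHom.ker π ≤ 𝔪 := by rwa [Ideal.mk_ker]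
  have hprime : (𝔪.map π).IsPrime := Ideal.map_isPrime_of_surjective hπ hker
  have hcm : (𝔪.map π).comap π = 𝔪 := by
    rw [Ideal.comap_map_of_surjective' _ hπ, sup_eq_left]
    exact hker
  have hheight : (𝔪.map π).height ≤ d := by
    refine Ideal.height_le_of_forall_ringKrullDim_quotient_le fun P hP hPm => ?_
    have h1 := h (P.comap π) inferInstance (by
      intro x hx
      rw [Ideal.mem_comap, Ideal.Quotient.eq_zero_iff_mem.mpr hx]
      exact P.zero_mem) (hcm ▸ Ideal.comap_mono hPm)
    exact (ringKrullDim_le_of_surjective (Ideal.quotientMap P π le_rfl)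
      (Ideal.quotientMap_surjective hπ)).trans h1
  obtain ⟨s, hs, hcard⟩ := (𝔪.map π).exists_finset_card_eq_height_of_isNoetherianRing
  let σ := Function.surjInv hπ
  have hσ (x) : π (σ x) = x := Function.surjInv_eq hπ x
  have hsd : s.card ≤ d := by exact_mod_cast hcard.trans_le hheight
  let l : List S := s.toList.map fun x => f (σ x)
  have hmem {x} (hx : x ∈ s) : σ x ∈ 𝔪 := by
    rw [← hcm, Ideal.mem_comap, hσ]
    exact hs.1.2 (Ideal.subset_span hx)
  have hfm {x} (hx : x ∈ 𝔪) : f x ∈ maximalIdeal S := by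
    rwa [← Ideal.mem_comap, hcomap]
  have hJm : J.map f ≤ maximalIdeal S := Ideal.map_le_iff_le_comap.mpr (hcomap ▸ hJ)
  have hzero : ringKrullDim (S ⧸ (J.map f ⊔ Ideal.span {x | x ∈ l})) ≤ (0 : ℕ) := by
    rw [ringKrullDim_quotient]
    have huniq (Q : PrimeSpectrum S)
        (hQ : Q ∈ PrimeSpectrum.zeroLocus
          ((J.map f ⊔ Ideal.span {x | x ∈ l} : Ideal S) : Set S)) :
        Q.asIdeal = maximalIdeal S := by
      have hQ' : J.map f ⊔ Ideal.span {x | x ∈ l} ≤ Q.asIdeal := hQ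
      refine le_antisymm (IsLocalRing.le_maximalIdeal Q.2.ne_top) (hmap.trans ?_)
      rw [Ideal.map_le_iff_le_comap]
      let P := Q.asIdeal.comap f
      have hJP : RingHom.ker π ≤ P := by
        rw [Ideal.mk_ker, ← Ideal.map_le_iff_le_comap]
        exact le_sup_left.trans hQ'
      have hPπ : (P.map π).comap π = P := by
        rw [Ideal.comap_map_of_surjective' _ hπ, sup_eq_left]
        exact hJP
      have hPm : P ≤ 𝔪 := by
        rw [← hcomap]
        exact Ideal.comap_mono (IsLocalRing.le_maximalIdeal Q.2.ne_top)
      have hle : 𝔪.map π ≤ P.map π := by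
        refine hs.2 ⟨Ideal.map_isPrime_of_surjective hπ hJP, ?_⟩ (Ideal.map_mono hPm)
        rw [Ideal.span_le]
        intro x hx
        rw [← hσ x]
        refine Ideal.mem_map_of_mem π ?_
        exact hQ' (Ideal.mem_sup_right (Ideal.subset_span
          (List.mem_map.mpr ⟨x, by simpa using hx, rfl⟩)))
      calc 𝔪 = (𝔪.map π).comap π := hcm.symm
        _ ≤ (P.map π).comap π := Ideal.comap_mono hle
        _ = P := hPπ
    have : Subsingleton (PrimeSpectrum.zeroLocus
        ((J.map f ⊔ Ideal.span {x | x ∈ l} : Ideal S) : Set S)) :=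
      ⟨fun a b => Subtype.ext (PrimeSpectrum.ext ((huniq _ a.2).trans (huniq _ b.2).symm))⟩
    exact Order.krullDim_nonpos_of_subsingleton
  have hl : ∀ x ∈ l, x ∈ maximalIdeal S := by
    intro x hx
    obtain ⟨y, hy, rfl⟩ := List.mem_map.mp hx
    exact hfm (hmem (by simpa using hy))
  refine (ringKrullDim_quotient_le_quotient_sup_span_list l hJm hl hzero).trans ?_
  simpa [l] using hsd

end Transfer

section SpecialFiber

open IsLocalRing

lemma helmIdeal_eq_map (A : Type*) [CommRing A] (q n : ℕ) :
    helmIdeal A q n = (Ideal.span (Set.range fun ij : Fin n × Fin n =>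
      ((1 + Matrix.of fun i j => MvPolynomial.X (1, i, j)) *
          (1 + Matrix.of fun i j => MvPolynomial.X (0, i, j)) -
        (1 + Matrix.of fun i j => MvPolynomial.X (0, i, j)) ^ (q + 1) *
          (1 + Matrix.of fun i j => MvPolynomial.X (1, i, j)) :
        Matrix (Fin n) (Fin n) (MvPolynomial (Fin 2 × Fin n × Fin n) A)) ij.1 ij.2)).map
      MvPolynomial.coeToMvPowerSeries.ringHom := by
  have hX (k : Fin 2) : Xt (A := A) 2 n k = (1 + Matrix.of fun i j => MvPolynomial.X (k, i, j) :
      Matrix (Fin n) (Fin n) (MvPolynomial (Fin 2 × Fin n × Fin n) A)).map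
      MvPolynomial.coeToMvPowerSeries.ringHom := by
    rw [Xt, varMatrix, Matrix.map_add _ (map_add _), Matrix.map_one _ (map_zero _) (map_one _)]
    congr 1
    ext1 i j
    simp
  rw [helmIdeal, Ideal.map_span, ← Set.range_comp]
  congr 2
  ext1 ij
  rw [hX, hX, Function.comp_apply, ← Matrix.map_apply (f := MvPolynomial.coeToMvPowerSeries.ringHom),
    Matrix.map_sub _ (map_sub _), Matrix.map_mul, Matrix.map_mul, Matrix.map_pow]

lemma MvPowerSeries.maximalIdeal_le_map_comap_constantCoeff {σ A : Type*} [Finite σ] [CommRing A]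
    [IsLocalRing A] :
    maximalIdeal (MvPowerSeries σ A) ≤ ((maximalIdeal A).comap MvPolynomial.constantCoeff).map
      (MvPolynomial.coeToMvPowerSeries.ringHom : MvPolynomial σ A →+* MvPowerSeries σ A) := by
  classical
  have := Fintype.ofFinite σ
  intro g hg
  set I := ((maximalIdeal A).comap MvPolynomial.constantCoeff).map
      (MvPolynomial.coeToMvPowerSeries.ringHom : MvPolynomial σ A →+* MvPowerSeries σ A)
  have hc : constantCoeff g ∈ maximalIdeal A := by
    rw [mem_maximalIdeal, mem_nonunits_iff] at hg ⊢
    rwa [MvPowerSeries.isUnit_iff_constantCoeff] at hg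
  have hX : Ideal.span (X '' (Finset.univ : Finset σ)) ≤ I := by
    rw [Ideal.span_le]
    rintro _ ⟨i, -, rfl⟩
    have : (MvPolynomial.X i : MvPolynomial σ A) ∈
      (maximalIdeal A).comap MvPolynomial.constantCoeff := by simp
    simpa using Ideal.mem_map_of_mem MvPolynomial.coeToMvPowerSeries.ringHom this
  have hC : C (constantCoeff g) ∈ I := by
    have : (MvPolynomial.C (constantCoeff g) : MvPolynomial σ A) ∈
      (maximalIdeal A).comap MvPolynomial.constantCoeff := by simpa using hc
    simpa using Ideal.mem_map_of_mem MvPolynomial.coeToMvPowerSeries.ringHom this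
  rw [← sub_add_cancel g (C (constantCoeff g))]
  refine I.add_mem (hX ((mem_span_X_image_iff _ _).mpr fun m hm => ?_)) hC
  have : m = 0 := Finsupp.ext fun i => hm i (Finset.mem_univ i)
  simp [this]

/-- The special fibre of Helm's moduli space has dimension at most `n²`. -/
lemma ringKrullDim_quotient_helmIdeal_sup_le {A : Type*} [CommRing A] [IsNoetherianRing A]
    [IsLocalRing A] {a : A} (ha : a ∈ maximalIdeal A)
    (hmax : ∀ P : Ideal A, P.IsPrime → a ∈ P → P = maximalIdeal A) {q : ℕ} (hq : 1 ≤ q) (n : ℕ) :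
    ringKrullDim (MvPowerSeries (Fin 2 × Fin n × Fin n) A ⧸
      (helmIdeal A q n ⊔ Ideal.span {MvPowerSeries.C a})) ≤ (n ^ 2 : ℕ) := by
  let f : MvPolynomial (Fin 2 × Fin n × Fin n) A →+* MvPowerSeries (Fin 2 × Fin n × Fin n) A :=
    MvPolynomial.coeToMvPowerSeries.ringHom
  let Z (k : Fin 2) : Matrix (Fin n) (Fin n) (MvPolynomial (Fin 2 × Fin n × Fin n) A) :=
    1 + Matrix.of fun i j => MvPolynomial.X (k, i, j)
  let J : Ideal (MvPolynomial (Fin 2 × Fin n × Fin n) A) :=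
    Ideal.span (Set.range fun ij : Fin n × Fin n => (Z 1 * Z 0 - Z 0 ^ (q + 1) * Z 1) ij.1 ij.2)
  have hmap : helmIdeal A q n ⊔ Ideal.span {MvPowerSeries.C a} =
      (J ⊔ Ideal.span {MvPolynomial.C a}).map f := by
    rw [Ideal.map_sup, helmIdeal_eq_map, Ideal.map_span _ {_}, Set.image_singleton]
    simp [f, J, Z]
  have hZ (k : Fin 2) : (Z k).map MvPolynomial.constantCoeff = 1 := by
    ext i j
    simp [Z, Matrix.one_apply, apply_ite]
  have hprime : ((maximalIdeal A).comap
    (MvPolynomial.constantCoeff (σ := Fin 2 × Fin n × Fin n))).IsPrime := inferInstance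
  rw [hmap]
  refine ringKrullDim_quotient_map_le f
    (𝔪 := (maximalIdeal A).comap MvPolynomial.constantCoeff) ?_ ?_
    MvPowerSeries.maximalIdeal_le_map_comap_constantCoeff ?_
  · refine sup_le (Ideal.span_le.mpr ?_) ((Ideal.span_singleton_le_iff_mem _).mpr (by simpa))
    rintro _ ⟨ij, rfl⟩
    have h : (Z 1 * Z 0 - Z 0 ^ (q + 1) * Z 1).map MvPolynomial.constantCoeff = 0 := by
      rw [Matrix.map_sub _ (map_sub _), Matrix.map_mul, Matrix.map_mul, Matrix.map_pow, hZ, hZ]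
      simp
    have h' : MvPolynomial.constantCoeff ((Z 1 * Z 0 - Z 0 ^ (q + 1) * Z 1) ij.1 ij.2) = 0 :=
      congrFun (congrFun h ij.1) ij.2
    simp only [SetLike.mem_coe, Ideal.mem_comap, h', zero_mem]
  · ext x
    simp only [Ideal.mem_comap, mem_maximalIdeal, mem_nonunits_iff,
      MvPowerSeries.isUnit_iff_constantCoeff]
    simp [f, ← MvPowerSeries.coeff_zero_eq_constantCoeff_apply, MvPolynomial.constantCoeff_eq]
  · intro P hP hJP hPm
    let π := Ideal.Quotient.mk P
    have haP : P.comap MvPolynomial.C = maximalIdeal A :=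
      hmax _ inferInstance (hJP (Ideal.mem_sup_right (Ideal.mem_span_singleton_self _)))
    let φ : ResidueField A →+* MvPolynomial (Fin 2 × Fin n × Fin n) A ⧸ P :=
      Ideal.Quotient.lift _ (π.comp MvPolynomial.C) fun x hx => by
        rw [← haP, Ideal.mem_comap] at hx
        simpa [π] using Ideal.Quotient.eq_zero_iff_mem.mpr hx
    let := φ.toAlgebra
    have hφ (x : A) : φ (residue A x) = π (MvPolynomial.C x) := rfl
    have hdet : ((Z 1).map π).det ≠ 0 := by
      rw [← RingHom.mapMatrix_apply, ← RingHom.map_det]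
      intro h
      have h1 := hPm (Ideal.Quotient.eq_zero_iff_mem.mp h)
      rw [Ideal.mem_comap, RingHom.map_det, RingHom.mapMatrix_apply, hZ, Matrix.det_one] at h1
      exact (Ideal.ne_top_iff_one _).mp (maximalIdeal.isMaximal A).ne_top h1
    have hrel : (Z 1).map π * (Z 0).map π = (Z 0).map π ^ (q + 1) * (Z 1).map π := by
      rw [← sub_eq_zero, ← Matrix.map_pow, ← Matrix.map_mul, ← Matrix.map_mul,
        ← Matrix.map_sub _ (map_sub _)]
      ext i j
      exact Ideal.Quotient.eq_zero_iff_mem.mpr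
        (hJP (Ideal.mem_sup_left (Ideal.subset_span ⟨(i, j), rfl⟩)))
    refine ringKrullDim_le_sq_card_of_mul_eq_pow_mul (k := ResidueField A) (by lia) hdet hrel ?_
    rw [eq_top_iff]
    rintro y -
    obtain ⟨y, rfl⟩ := Ideal.Quotient.mk_surjective y
    set B := Algebra.adjoin (ResidueField A)
      ((Set.range fun ij : Fin n × Fin n => (Z 1).map π ij.1 ij.2) ∪
        Set.range fun ij : Fin n × Fin n => (Z 0).map π ij.1 ij.2)
    have hmem (k : Fin 2) (i j : Fin n) : π (Z k i j) ∈ B := by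
      refine Algebra.subset_adjoin ?_
      fin_cases k
      · exact Or.inr ⟨(i, j), rfl⟩
      · exact Or.inl ⟨(i, j), rfl⟩
    have hX (v : Fin 2 × Fin n × Fin n) : π (MvPolynomial.X v) ∈ B := by
      have h := B.sub_mem (hmem v.1 v.2.1 v.2.2)
        (show π ((1 : Matrix (Fin n) (Fin n) _) v.2.1 v.2.2) ∈ B by
          rw [Matrix.one_apply]
          split_ifs <;> simp)
      rw [← map_sub] at h
      simpa [Z] using h
    induction y using MvPolynomial.induction_on with
    | C x => exact hφ x ▸ B.algebraMap_mem (residue A x)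
    | add _ _ h1 h2 => exact map_add π _ _ ▸ B.add_mem h1 h2
    | mul_X _ v h => exact map_mul π _ _ ▸ B.mul_mem h (hX v)

end SpecialFiber

section RingOfIntegers

variable (p : ℕ) [Fact p.Prime] (L : Type*) [Field L] [Algebra ℤ_[p] L]
  [Algebra ℚ_[p] L]

lemma RingOfIntegers.natCast_prime_ne_zero : (p : RingOfIntegers p L) ≠ 0 := by
  have : CharZero L := charZero_of_injective_algebraMap (algebraMap ℚ_[p] L).injective
  intro h
  have h1 : ((p : RingOfIntegers p L) : L) = 0 := by rw [h]; rfl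
  rw [SubringClass.coe_natCast, Nat.cast_eq_zero] at h1
  exact (Fact.out : p.Prime).ne_zero h1

variable [FiniteDimensional ℚ_[p] L] [IsScalarTower ℤ_[p] ℚ_[p] L]

lemma isIntegral_padicInt_iff_spectralNorm_le_one (x : L) :
    IsIntegral ℤ_[p] x ↔ spectralNorm ℚ_[p] L x ≤ 1 := by
  have hx : IsIntegral ℚ_[p] x := Algebra.IsIntegral.isIntegral x
  rw [spectralNorm, spectralValue_le_one_iff (minpoly.monic hx)]
  constructor
  · intro h i
    rw [minpoly.isIntegrallyClosed_eq_field_fractions' ℚ_[p] h, Polynomial.coeff_map]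
    exact PadicInt.norm_le_one _
  · intro h
    have hl : minpoly ℚ_[p] x ∈ Polynomial.lifts (algebraMap ℤ_[p] ℚ_[p]) := by
      rw [Polynomial.lifts_iff_coeff_lifts]
      exact fun i => ⟨⟨_, h i⟩, rfl⟩
    obtain ⟨g, hg, -, hgm⟩ := Polynomial.lifts_and_natDegree_eq_and_monic hl (minpoly.monic hx)
    refine ⟨g, hgm, ?_⟩
    rw [IsScalarTower.algebraMap_eq ℤ_[p] ℚ_[p] L, ← Polynomial.eval₂_map, hg]
    exact minpoly.aeval _ _

lemma RingOfIntegers.isUnit_of_spectralNorm_eq_one (x : RingOfIntegers p L)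
    (hx : spectralNorm ℚ_[p] L x = 1) : IsUnit x := by
  have h0 : (x : L) ≠ 0 := by
    intro h
    rw [h, spectralNorm_zero] at hx
    exact zero_ne_one hx
  have hinv : spectralNorm ℚ_[p] L (x : L)⁻¹ = 1 := by
    have h := map_mul (spectralMulAlgNorm ℚ_[p] L) (x : L) (x : L)⁻¹
    rw [mul_inv_cancel₀ h0] at h
    simp only [spectralMulAlgNorm_def, hx, one_mul, spectralNorm_one] at h
    exact h.symm
  refine IsUnit.of_mul_eq_one
    ⟨(x : L)⁻¹, (isIntegral_padicInt_iff_spectralNorm_le_one p L _).mpr hinv.le⟩ ?_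
  exact Subtype.ext (mul_inv_cancel₀ h0)

lemma RingOfIntegers.isLocalRing : IsLocalRing (RingOfIntegers p L) := by
  have hlt {x : RingOfIntegers p L} (hx : x ∈ nonunits _) : spectralNorm ℚ_[p] L x < 1 :=
    lt_of_le_of_ne ((isIntegral_padicInt_iff_spectralNorm_le_one p L x).mp x.2)
      fun h => hx (isUnit_of_spectralNorm_eq_one p L x h)
  refine IsLocalRing.of_nonunits_add fun a b ha hb hab => ?_
  obtain ⟨u, hu⟩ := hab.exists_right_inv
  have h1 : spectralNorm ℚ_[p] L ((a + b : RingOfIntegers p L) : L) < 1 :=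
    (isNonarchimedean_spectralNorm _ _).trans_lt (max_lt (hlt ha) (hlt hb))
  have h2 := (isIntegral_padicInt_iff_spectralNorm_le_one p L u).mp u.2
  have h := map_mul (spectralMulAlgNorm ℚ_[p] L) ((a + b : RingOfIntegers p L) : L) u
  rw [← MulMemClass.coe_mul, hu, OneMemClass.coe_one] at h
  simp only [spectralMulAlgNorm_def, spectralNorm_one] at h
  exact absurd h (mul_lt_one_of_nonneg_of_lt_one_left (spectralNorm_nonneg _) h1 h2).ne'

lemma RingOfIntegers.isDedekindDomain : IsDedekindDomain (RingOfIntegers p L) :=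
  integralClosure.isDedekindDomain ℤ_[p] ℚ_[p] L

lemma RingOfIntegers.natCast_prime_not_isUnit : ¬ IsUnit (p : RingOfIntegers p L) := by
  intro h
  obtain ⟨u, hu⟩ := h.exists_right_inv
  have h2 := (isIntegral_padicInt_iff_spectralNorm_le_one p L u).mp u.2
  have h := map_mul (spectralMulAlgNorm ℚ_[p] L) (algebraMap ℚ_[p] L p) u
  rw [map_natCast, ← SubringClass.coe_natCast (integralClosure ℤ_[p] L), ← MulMemClass.coe_mul, hu,
    SubringClass.coe_natCast, OneMemClass.coe_one, ← map_natCast (algebraMap ℚ_[p] L)] at h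
  simp only [spectralMulAlgNorm_def, spectralNorm_one, spectralNorm_extends] at h
  exact absurd h (mul_lt_one_of_nonneg_of_lt_one_left (norm_nonneg _)
    Padic.norm_p_lt_one h2).ne'

end RingOfIntegers

section Assembly

open IsLocalRing

lemma exists_list_length_eq_helmIdeal (A : Type*) [CommRing A] (q n : ℕ) :
    ∃ l : List (MvPowerSeries (Fin 2 × Fin n × Fin n) A),
      l.length = n ^ 2 ∧ helmIdeal A q n = Ideal.span {x | x ∈ l} := by
  refine ⟨(Finset.univ : Finset (Fin n × Fin n)).toList.map fun ij =>
    (Xt (A := A) 2 n 1 * Xt (A := A) 2 n 0 -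
      (Xt (A := A) 2 n 0) ^ (q + 1) * Xt (A := A) 2 n 1) ij.1 ij.2, ?_, ?_⟩
  · simp [sq]
  · rw [helmIdeal]
    congr 1
    ext x
    simp

lemma helmIdeal_le_maximalIdeal (A : Type*) [CommRing A] [IsLocalRing A] (q n : ℕ) :
    helmIdeal A q n ≤ maximalIdeal (MvPowerSeries (Fin 2 × Fin n × Fin n) A) := by
  have hX (k : Fin 2) : (Xt (A := A) 2 n k).map MvPowerSeries.constantCoeff = 1 := by
    ext i j
    simp [Xt, varMatrix, Matrix.one_apply, apply_ite]
  have h : (Xt (A := A) 2 n 1 * Xt (A := A) 2 n 0 - (Xt (A := A) 2 n 0) ^ (q + 1) *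
      Xt (A := A) 2 n 1).map MvPowerSeries.constantCoeff = 0 := by
    rw [Matrix.map_sub _ (map_sub _), Matrix.map_mul, Matrix.map_mul, Matrix.map_pow, hX, hX]
    simp
  rw [helmIdeal, Ideal.span_le]
  rintro _ ⟨ij, rfl⟩
  have h' := congrFun (congrFun h ij.1) ij.2
  rw [Matrix.map_apply, Matrix.zero_apply] at h'
  rw [SetLike.mem_coe, mem_maximalIdeal, mem_nonunits_iff, MvPowerSeries.isUnit_iff_constantCoeff,
    h']
  exact not_isUnit_zero

lemma MvPowerSeries.C_mem_maximalIdeal {σ A : Type*} [CommRing A] [IsLocalRing A] {a : A}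
    (ha : a ∈ maximalIdeal A) :
    C a ∈ maximalIdeal (MvPowerSeries σ A) := by
  rwa [mem_maximalIdeal, mem_nonunits_iff, isUnit_iff_constantCoeff, constantCoeff_C]

section

variable {A : Type*} [CommRing A] [IsDedekindDomain A] [IsLocalRing A] {a : A} {q : ℕ} (n : ℕ)

lemma ringKrullDim_quotient_helmIdeal_sup_le_of_ne_zero (ha : a ∈ maximalIdeal A) (ha0 : a ≠ 0)
    (hq : 1 ≤ q) :
    ringKrullDim (MvPowerSeries (Fin 2 × Fin n × Fin n) A ⧸
      (helmIdeal A q n ⊔ Ideal.span {MvPowerSeries.C a})) ≤ (n ^ 2 : ℕ) :=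
  ringKrullDim_quotient_helmIdeal_sup_le ha (fun P hP haP =>
    eq_maximalIdeal (hP.isMaximal fun h => ha0 (by rwa [h] at haP))) hq n

lemma ringKrullDim_helmLocalRing_le (ha : a ∈ maximalIdeal A) (ha0 : a ≠ 0) (hq : 1 ≤ q) :
    ringKrullDim (helmLocalRing A q n) ≤ (n ^ 2 + 1 : ℕ) := by
  refine (ringKrullDim_quotient_le_quotient_sup_span_singleton (helmIdeal_le_maximalIdeal A q n)
    (MvPowerSeries.C_mem_maximalIdeal ha)).trans ?_
  push_cast
  gcongr
  exact_mod_cast ringKrullDim_quotient_helmIdeal_sup_le_of_ne_zero n ha ha0 hq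

lemma depthAtLeast_helmIdeal (ha : a ∈ maximalIdeal A) (ha0 : a ≠ 0) (hq : 1 ≤ q) :
    DepthAtLeast (helmIdeal A q n) (n ^ 2 + 1) := by
  obtain ⟨l, hl, hspan⟩ := exists_list_length_eq_helmIdeal A q n
  have hm := helmIdeal_le_maximalIdeal A q n
  have h := MvPowerSeries.depthAtLeast_bot (σ := Fin 2 × Fin n × Fin n) ha0 ha
  have hcard : Fintype.card (Fin 2 × Fin n × Fin n) + 1 = n ^ 2 + 1 + l.length := by
    rw [hl]
    simp
    ring
  rw [hcard] at h
  have := h.sup_span_list l (fun x hx => hm (hspan ▸ Ideal.subset_span hx))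
    (by
      rw [bot_sup_eq, ← hspan]
      exact ringKrullDim_helmLocalRing_le n ha ha0 hq)
  rwa [bot_sup_eq, ← hspan] at this

lemma regularMod_helmIdeal (ha : a ∈ maximalIdeal A) (ha0 : a ≠ 0) (hq : 1 ≤ q) :
    RegularMod (helmIdeal A q n) (MvPowerSeries.C a) :=
  (depthAtLeast_helmIdeal n ha ha0 hq).regularMod
    (ringKrullDim_quotient_helmIdeal_sup_le_of_ne_zero n ha ha0 hq)

lemma algebraMap_helmLocalRing_mem_nonZeroDivisors (ha : a ∈ maximalIdeal A)
    (ha0 : a ≠ 0) (hq : 1 ≤ q) :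
    algebraMap A (helmLocalRing A q n) a ∈ nonZeroDivisors (helmLocalRing A q n) := by
  rw [mem_nonZeroDivisors_iff_right]
  intro x hx
  obtain ⟨x, rfl⟩ := Ideal.Quotient.mk_surjective x
  rw [Ideal.Quotient.eq_zero_iff_mem]
  refine regularMod_helmIdeal n ha ha0 hq x ?_
  rw [mul_comm, ← Ideal.Quotient.eq_zero_iff_mem]
  exact hx

lemma ringKrullDim_helmLocalRing (ha : a ∈ maximalIdeal A) (ha0 : a ≠ 0) (hq : 1 ≤ q) :
    ringKrullDim (helmLocalRing A q n) = (n ^ 2 + 1 : ℕ) :=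
  le_antisymm (ringKrullDim_helmLocalRing_le n ha ha0 hq)
    (depthAtLeast_helmIdeal n ha ha0 hq).le_ringKrullDim

lemma ringKrullDim_helmLocalRing_quotient (ha : a ∈ maximalIdeal A) (ha0 : a ≠ 0) (hq : 1 ≤ q) :
    ringKrullDim (helmLocalRing A q n ⧸ Ideal.span {algebraMap A (helmLocalRing A q n) a}) =
      (n ^ 2 : ℕ) := by
  let e := DoubleQuot.quotQuotEquivQuotSup (helmIdeal A q n) (Ideal.span {MvPowerSeries.C a})
  have hspan : Ideal.span {algebraMap A (helmLocalRing A q n) a} =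
      (Ideal.span {MvPowerSeries.C a}).map (Ideal.Quotient.mk (helmIdeal A q n)) := by
    rw [Ideal.map_span, Set.image_singleton]
    rfl
  rw [hspan, ringKrullDim_eq_of_ringEquiv e]
  exact le_antisymm (ringKrullDim_quotient_helmIdeal_sup_le_of_ne_zero n ha ha0 hq)
    (((depthAtLeast_helmIdeal n ha ha0 hq).sup_span_singleton (MvPowerSeries.C_mem_maximalIdeal ha)
      (regularMod_helmIdeal n ha ha0 hq)).le_ringKrullDim)

lemma flat_helmLocalRing (hq : 1 ≤ q) : Module.Flat A (helmLocalRing A q n) := by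
  have : Module.IsTorsionFree A (helmLocalRing A q n) := by
    refine .of_smul_eq_zero fun r x hx => or_iff_not_imp_left.mpr fun hr => ?_
    by_cases hu : IsUnit r
    · rwa [hu.smul_eq_zero] at hx
    · exact mem_nonZeroDivisors_iff_right.mp
        (algebraMap_helmLocalRing_mem_nonZeroDivisors n hu hr hq) x
        ((mul_comm _ _).trans ((Algebra.smul_def r x).symm.trans hx))
  infer_instance

end

end Assembly

/-- `p` is not a zero divisor in `R'` (so `R'` is flat over `𝒪_L`), the Krull dimension of
`R'` is `n² + 1`, and the Krull dimension of `R'/(p)` is `n²`. -/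
theorem helm_local_ring_flat_and_dimension
    (p s q n : ℕ) (hs : 1 ≤ s) (hq : q = p ^ s) (hq3 : 3 ≤ q) (hn : 1 ≤ n) [Fact p.Prime]
    (L : Type) [Field L] [Algebra ℚ_[p] L] [FiniteDimensional ℚ_[p] L]
    [Algebra ℤ_[p] L] [IsScalarTower ℤ_[p] ℚ_[p] L] :
    (p : helmLocalRing (RingOfIntegers p L) q n) ∈
        nonZeroDivisors (helmLocalRing (RingOfIntegers p L) q n) ∧
    Module.Flat (RingOfIntegers p L) (helmLocalRing (RingOfIntegers p L) q n) ∧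
    ringKrullDim (helmLocalRing (RingOfIntegers p L) q n) = (n ^ 2 + 1 : ℕ) ∧
    ringKrullDim (helmLocalRing (RingOfIntegers p L) q n ⧸
        Ideal.span {(p : helmLocalRing (RingOfIntegers p L) q n)}) = (n ^ 2 : ℕ) := by
  have := RingOfIntegers.isLocalRing p L
  have := RingOfIntegers.isDedekindDomain p L
  have hpm : (p : RingOfIntegers p L) ∈ IsLocalRing.maximalIdeal _ :=
    RingOfIntegers.natCast_prime_not_isUnit p L
  have hp0 := RingOfIntegers.natCast_prime_ne_zero p L
  have hq1 : 1 ≤ q := by lia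
  rw [← map_natCast (algebraMap (RingOfIntegers p L) (helmLocalRing (RingOfIntegers p L) q n))]
  exact ⟨algebraMap_helmLocalRing_mem_nonZeroDivisors n hpm hp0 hq1, flat_helmLocalRing n hq1,
    ringKrullDim_helmLocalRing n hpm hp0 hq1, ringKrullDim_helmLocalRing_quotient n hpm hp0 hq1⟩
end
end

section
/- Let L be a finite extension of ℚ_p and 𝒪_L the integral closure of ℤ_p in L. Let R be a commutative Noetherian local ring that is complete with respect to its maximal ideal 𝔪_R, whose residue field R/𝔪_R is finite, equipped with an 𝒪_L-algebra structure whose structure map 𝒪_L → R is a local homomorphism. Then for every maximal ideal 𝔪 of the localization R[1/p], the residue field κ(𝔪) = R[1/p]/𝔪 is finite-dimensional as an L-vector space (via the natural L-algebra structure on R[1/p], identifying L with 𝒪_L[1/p]), and every element of the image of the natural map R → κ(𝔪) is integral over 𝒪_L. -/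
set_option synthInstance.maxHeartbeats 1000000
set_option maxHeartbeats 1000000

noncomputable section

open IsLocalRing

instance IsPrecomplete.pi {R : Type*} [CommRing R] (I : Ideal R) [IsPrecomplete I R]
    (ι : Type*) [Finite ι] : IsPrecomplete I (ι → R) where
  prec' f hf := by
    classical
    cases nonempty_fintype ι
    have key (i : ι) : ∃ l : R, ∀ n, f n i ≡ l [SMOD (I ^ n • ⊤ : Ideal R)] := by
      refine IsPrecomplete.prec inferInstance fun {m n} hmn ↦ ?_
      have := (hf hmn).map (LinearMap.proj (R := R) (φ := fun _ : ι ↦ R) i)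
      exact this.mono ((Submodule.map_smul'' _ _ _).trans_le (Submodule.smul_mono le_rfl le_top))
    choose l hl using key
    refine ⟨l, fun n ↦ ?_⟩
    rw [SModEq.sub_mem, pi_eq_sum_univ' (f n - l)]
    refine Submodule.sum_mem _ fun i _ ↦ Submodule.smul_mem_smul ?_ trivial
    have := hl i n
    rwa [SModEq.sub_mem, smul_eq_mul, Ideal.mul_top] at this

/-- The complete version of Nakayama's lemma. -/
theorem Module.Finite.of_finite_quotient_smul_top {R M : Type*} [CommRing R] [AddCommGroup M]
    [Module R M] (I : Ideal R) [IsPrecomplete I R] [IsHausdorff I M]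
    [Module.Finite R (M ⧸ (I • ⊤ : Submodule R M))] : Module.Finite R M := by
  obtain ⟨n, g, hg⟩ := Module.Finite.exists_fin' R (M ⧸ (I • ⊤ : Submodule R M))
  obtain ⟨f, hf⟩ := Module.projective_lifting_property _ g (Submodule.mkQ_surjective (I • ⊤))
  exact .of_surjective f (surjective_of_mkQ_comp_surjective (I := I) (hf ▸ hg))

/-- In a Noetherian local domain in which every nonzero prime ideal contains a fixed nonzero
nonunit `x`, some power of the maximal ideal is contained in `(x)`. -/
theorem IsLocalRing.exists_maximalIdeal_pow_le_span_singleton {A : Type*} [CommRing A] [IsDomain A]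
    [IsNoetherianRing A] [IsLocalRing A] {x : A} (hx : x ∈ maximalIdeal A) (hx0 : x ≠ 0)
    (h : ∀ Q : Ideal A, Q.IsPrime → Q ≠ ⊥ → x ∈ Q) :
    ∃ n, maximalIdeal A ^ n ≤ Ideal.span {x} := by
  have hfin := Ideal.finite_minimalPrimes_of_isNoetherianRing A (Ideal.span {x})
  have hcover : (maximalIdeal A : Set A) ⊆ ⋃ Q ∈ (Ideal.span {x}).minimalPrimes, (Q : Set A) := by
    intro y hy
    suffices ∃ Q ∈ (Ideal.span {x}).minimalPrimes, y ∈ Q by simpa using this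
    by_cases hy0 : y = 0
    · obtain ⟨Q, hQ, -⟩ := Ideal.exists_minimalPrimes_le
        ((Ideal.span_singleton_le_iff_mem _).mpr hx)
      exact ⟨Q, hQ, hy0 ▸ Q.zero_mem⟩
    · obtain ⟨Q, hQ, -⟩ := Ideal.exists_minimalPrimes_le
        ((Ideal.span_singleton_le_iff_mem _).mpr hy)
      have : Q.IsPrime := hQ.isPrime
      have hyQ : y ∈ Q := (Ideal.span_singleton_le_iff_mem _).mp hQ.le
      have hxQ := h Q this fun hb ↦ hy0 (by simpa [hb] using hyQ)
      refine ⟨Q, ⟨⟨this, (Ideal.span_singleton_le_iff_mem _).mpr hxQ⟩, fun q hq hqQ ↦ ?_⟩, hyQ⟩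
      by_contra hlt
      have hq' := hq.1
      have hqx : x ∈ q := (Ideal.span_singleton_le_iff_mem _).mp hq.2
      have h1 := Ideal.height_le_one_of_isPrincipal_of_mem_minimalPrimes _ Q hQ
      have h2 := (Ideal.height_le_iff (n := 1)).mp h1 q hq' (lt_of_le_not_ge hqQ hlt)
      have h3 : q = ⊥ := Ideal.height_eq_zero_iff_eq_bot.mp (by simpa using h2)
      exact hx0 (by simpa [h3] using hqx)
  obtain ⟨Q, hQ, hle⟩ := (Ideal.subset_union_prime_finite hfin (f := id) ⊥ ⊥
    fun i hi _ _ ↦ hi.isPrime).mp hcover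
  refine Ideal.exists_pow_le_of_le_radical_of_fg ?_ (IsNoetherian.noetherian _)
  rw [Ideal.radical_eq_sInf]
  refine le_sInf fun J hJ ↦ hle.trans (hQ.2 ⟨hJ.2, hJ.1⟩ ?_)
  exact (le_maximalIdeal hJ.2.ne_top).trans hle

theorem Module.Finite.padicInt_of_maximalIdeal_pow_le (p : ℕ) [Fact p.Prime] {A : Type*}
    [CommRing A] [IsNoetherianRing A] [IsLocalRing A] [Finite (ResidueField A)] [Algebra ℤ_[p] A]
    (hp : (p : A) ∈ maximalIdeal A) {n : ℕ} (hn : maximalIdeal A ^ n ≤ Ideal.span {(p : A)}) :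
    Module.Finite ℤ_[p] A := by
  have hmap : (maximalIdeal ℤ_[p]).map (algebraMap ℤ_[p] A) = Ideal.span {(p : A)} := by
    simp [PadicInt.maximalIdeal_eq_span_p, Ideal.map_span]
  have : IsHausdorff (maximalIdeal ℤ_[p]) A :=
    .of_map (J := maximalIdeal A) (hmap ▸ (Ideal.span_singleton_le_iff_mem _).mpr hp)
  have hfin : Finite (A ⧸ Ideal.span {(p : A)}) := finite_quotient_iff.mpr ⟨n, hn⟩
  have : Finite (A ⧸ (maximalIdeal ℤ_[p] • ⊤ : Submodule ℤ_[p] A)) := by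
    rw [Ideal.smul_top_eq_map, hmap]
    exact hfin
  exact .of_finite_quotient_smul_top (maximalIdeal ℤ_[p])

/-- A Noetherian local domain `A` with finite residue field of characteristic `p` for which
`A[1/p]` is a field is finite over `ℤ_[p]`. -/
theorem Module.Finite.padicInt_of_isUnit_away (p : ℕ) [Fact p.Prime] {A K : Type*}
    [CommRing A] [IsNoetherianRing A] [IsLocalRing A] [Finite (ResidueField A)] [Algebra ℤ_[p] A]
    (hp : (p : A) ∈ maximalIdeal A) [Field K] (φ : A →+* K) (hφ : Function.Injective φ)
    (hp0 : (p : K) ≠ 0) (hK : ∀ k : K, ∃ (a : A) (n : ℕ), k * (p : K) ^ n = φ a) :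
    Module.Finite ℤ_[p] A := by
  have : IsDomain A := hφ.isDomain φ
  obtain ⟨n, hn⟩ := exists_maximalIdeal_pow_le_span_singleton hp
    (fun h ↦ hp0 (by simpa using congrArg φ h)) fun Q hQ hQ0 ↦ by
      obtain ⟨a, haQ, ha0⟩ := Q.ne_bot_iff.mp hQ0
      obtain ⟨b, n, hb⟩ := hK (φ a)⁻¹
      have hab : a * b = (p : A) ^ n := hφ <| by
        rw [map_mul, ← hb, map_pow, map_natCast,
          mul_inv_cancel_left₀ ((map_ne_zero_iff φ hφ).mpr ha0)]
      exact hQ.mem_of_pow_mem n (hab ▸ Q.mul_mem_right b haQ)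
  exact .padicInt_of_maximalIdeal_pow_le p hp hn

/-- If every element of a field `K` over `L` becomes, after multiplication by a power of `p`, an
element of the image of a finite `ℤ_[p]`-algebra `A`, then `K` is finite over `L`. -/
theorem FiniteDimensional.of_finite_padicInt (p : ℕ) [Fact p.Prime] {A K L : Type*} [CommRing A]
    [Algebra ℤ_[p] A] [Module.Finite ℤ_[p] A] [Field L] [Algebra ℤ_[p] L] [Field K] [Algebra L K]
    (hp0 : (p : K) ≠ 0) (φ : A →+* K)
    (hcomp : ∀ z : ℤ_[p], φ (algebraMap ℤ_[p] A z) = algebraMap L K (algebraMap ℤ_[p] L z))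
    (hK : ∀ k : K, ∃ (a : A) (n : ℕ), k * (p : K) ^ n = φ a) : FiniteDimensional L K := by
  obtain ⟨s, hs⟩ := Module.Finite.fg_top (R := ℤ_[p]) (M := A)
  classical
  refine ⟨⟨s.image φ, eq_top_iff.mpr fun k _ ↦ ?_⟩⟩
  have hA (a : A) : φ a ∈ Submodule.span L ((s.image φ : Finset K) : Set K) := by
    have ha : a ∈ Submodule.span ℤ_[p] (s : Set A) := hs ▸ trivial
    induction ha using Submodule.span_induction with
    | mem x hx => exact Submodule.subset_span (by simpa using ⟨x, hx, rfl⟩)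
    | zero => simp
    | add x y _ _ hx hy => simpa using add_mem hx hy
    | smul z x _ hx =>
      rw [Algebra.smul_def, map_mul, hcomp, ← Algebra.smul_def]
      exact Submodule.smul_mem _ _ hx
  obtain ⟨a, n, ha⟩ := hK k
  have hk : k = ((p : L) ^ n)⁻¹ • φ a := by
    rw [Algebra.smul_def, ← ha, map_inv₀, map_pow, map_natCast]
    field_simp
  exact hk ▸ Submodule.smul_mem _ _ (hA a)

/-- If `K` is a field of the form `(R/P)[1/p]` for a prime ideal `P` of `R`, then `K` is finite
over `L` and the image of `R` in `K` is integral over the ring of integers of `L`. -/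
theorem IsLocalRing.finiteDimensional_and_isIntegralElem_of_away
    (p : ℕ) [Fact p.Prime]
    {L : Type*} [Field L] [Algebra ℚ_[p] L] [FiniteDimensional ℚ_[p] L]
    [Algebra ℤ_[p] L] [IsScalarTower ℤ_[p] ℚ_[p] L]
    {R : Type*} [CommRing R] [IsNoetherianRing R] [IsLocalRing R]
    [Finite (IsLocalRing.ResidueField R)]
    [Algebra (RingOfIntegers p L) R] [IsLocalHom (algebraMap (RingOfIntegers p L) R)]
    {K : Type*} [Field K] (ψ : R →+* K) (hp0 : (p : K) ≠ 0)
    (hK : ∀ k : K, ∃ (r : R) (n : ℕ), k * (p : K) ^ n = ψ r) :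
    (∃ f : L →+* K,
      (∀ a : RingOfIntegers p L, f (algebraMap (RingOfIntegers p L) L a) =
        ψ (algebraMap (RingOfIntegers p L) R a)) ∧
      @FiniteDimensional L K _ _ f.toAlgebra.toModule) ∧
    ∀ r : R, (ψ.comp (algebraMap (RingOfIntegers p L) R)).IsIntegralElem (ψ r) := by
  let O := RingOfIntegers p L
  have hpR : (p : R) ∈ maximalIdeal R := by
    have hpO : ¬IsUnit (p : O) := fun h ↦ by
      have : IsUnit (algebraMap ℤ_[p] O p) := by simpa using h
      have hinj : Function.Injective (algebraMap ℤ_[p] O) := by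
        refine .of_comp (f := algebraMap O L) ?_
        rw [← RingHom.coe_comp, ← IsScalarTower.algebraMap_eq,
          IsScalarTower.algebraMap_eq ℤ_[p] ℚ_[p] L]
        exact (algebraMap ℚ_[p] L).injective.comp (IsFractionRing.injective ℤ_[p] ℚ_[p])
      have hloc : IsLocalHom (algebraMap ℤ_[p] O) :=
        (algebraMap_isIntegral_iff.mpr inferInstance).isLocalHom hinj
      exact PadicInt.p_nonunit (isUnit_of_map_unit (algebraMap ℤ_[p] O) _ this)
    intro h
    exact hpO (isUnit_of_map_unit (algebraMap O R) _ (by simpa using h))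
  let A := R ⧸ RingHom.ker ψ
  have : (RingHom.ker ψ).IsPrime := RingHom.ker_isPrime ψ
  have : IsLocalRing A :=
    .of_surjective' (Ideal.Quotient.mk (RingHom.ker ψ)) Ideal.Quotient.mk_surjective
  have : IsLocalHom (Ideal.Quotient.mk (RingHom.ker ψ)) :=
    .of_surjective _ Ideal.Quotient.mk_surjective
  have : Finite (ResidueField A) :=
    .of_surjective (ResidueField.map (Ideal.Quotient.mk (RingHom.ker ψ))) fun y ↦ by
      obtain ⟨x, rfl⟩ := residue_surjective y
      obtain ⟨r, rfl⟩ := Ideal.Quotient.mk_surjective x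
      exact ⟨residue R r, rfl⟩
  have hpA : (p : A) ∈ maximalIdeal A := by
    have := map_nonunit (Ideal.Quotient.mk (RingHom.ker ψ)) _ hpR
    rwa [map_natCast] at this
  let φ : A →+* K := RingHom.kerLift ψ
  have hφ (k : K) : ∃ (a : A) (n : ℕ), k * (p : K) ^ n = φ a := by
    obtain ⟨r, n, hr⟩ := hK k
    exact ⟨Ideal.Quotient.mk _ r, n, hr⟩
  let _ : Algebra ℤ_[p] A := ((Ideal.Quotient.mk (RingHom.ker ψ)).comp
    ((algebraMap O R).comp (algebraMap ℤ_[p] O))).toAlgebra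
  have : Module.Finite ℤ_[p] A :=
    .padicInt_of_isUnit_away p hpA φ (RingHom.kerLift_injective ψ) hp0 hφ
  refine ⟨?_, fun r ↦ ?_⟩
  · have : IsFractionRing O L := integralClosure.isFractionRing_of_finite_extension ℚ_[p] L
    let g : O →+* K := ψ.comp (algebraMap O R)
    have hg : Function.Injective g := by
      rw [RingHom.injective_iff_ker_eq_bot]
      refine Ideal.eq_bot_of_comap_eq_bot (R := ℤ_[p]) ?_
      by_contra hne
      obtain ⟨n, hn⟩ := PadicInt.ideal_eq_span_pow_p hne
      have : (p : ℤ_[p]) ^ n ∈ (RingHom.ker g).comap (algebraMap ℤ_[p] O) :=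
        hn ▸ Ideal.mem_span_singleton_self _
      exact pow_ne_zero n hp0 (by simpa [RingHom.mem_ker] using this)
    refine ⟨IsFractionRing.lift hg, fun a ↦ IsFractionRing.lift_algebraMap hg a, ?_⟩
    let _ : Algebra L K := (IsFractionRing.lift hg).toAlgebra
    exact .of_finite_padicInt p hp0 φ
      (fun z ↦ (IsFractionRing.lift_algebraMap hg (algebraMap ℤ_[p] O z)).symm) hφ
  · obtain ⟨q, hq, hqr⟩ := Algebra.IsIntegral.isIntegral (R := ℤ_[p]) (Ideal.Quotient.mk _ r : A)
    refine ⟨q.map (algebraMap ℤ_[p] O), hq.map _, ?_⟩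
    have := congrArg φ hqr
    rw [Polynomial.hom_eval₂, map_zero] at this
    rwa [Polynomial.eval₂_map]

/-- Let `R` be a complete Noetherian local `𝒪_L`-algebra with finite residue field, where
the structure map `𝒪_L → R` is local.  Then for every maximal ideal `𝔪` of `R[1/p]`, the
residue field `κ(𝔪)` is a finite extension of `L` and the image of `R` in `κ(𝔪)` is
integral over `𝒪_L`. -/
theorem residue_field_of_generic_fiber_is_finite_over_L
    (p : ℕ) [Fact p.Prime]
    (L : Type) [Field L] [Algebra ℚ_[p] L] [FiniteDimensional ℚ_[p] L]
    [Algebra ℤ_[p] L] [IsScalarTower ℤ_[p] ℚ_[p] L]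
    (R : Type) [CommRing R] [IsNoetherianRing R] [IsLocalRing R]
    [IsAdicComplete (IsLocalRing.maximalIdeal R) R]
    [Finite (IsLocalRing.ResidueField R)]
    [Algebra (RingOfIntegers p L) R] [IsLocalHom (algebraMap (RingOfIntegers p L) R)]
    (𝔪 : Ideal (Localization.Away (p : R))) (h𝔪 : 𝔪.IsMaximal) :
    (∃ f : L →+* (Localization.Away (p : R) ⧸ 𝔪),
      (∀ a : RingOfIntegers p L,
        f (algebraMap (RingOfIntegers p L) L a) =
          Ideal.Quotient.mk 𝔪
            (algebraMap R (Localization.Away (p : R))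
              (algebraMap (RingOfIntegers p L) R a))) ∧
      (@FiniteDimensional L (Localization.Away (p : R) ⧸ 𝔪) _ _
        f.toAlgebra.toModule)) ∧
    (∀ r : R,
      (((Ideal.Quotient.mk 𝔪).comp
          ((algebraMap R (Localization.Away (p : R))).comp
            (algebraMap (RingOfIntegers p L) R))).IsIntegralElem
        (Ideal.Quotient.mk 𝔪 (algebraMap R (Localization.Away (p : R)) r)))) := by
  let _ : Field (Localization.Away (p : R) ⧸ 𝔪) := Ideal.Quotient.field 𝔪
  have hp : IsUnit (p : Localization.Away (p : R)) := by
    simpa using IsLocalization.Away.algebraMap_isUnit (S := Localization.Away (p : R)) (p : R)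
  refine IsLocalRing.finiteDimensional_and_isIntegralElem_of_away p
    ((Ideal.Quotient.mk 𝔪).comp (algebraMap R (Localization.Away (p : R)))) ?_ fun k ↦ ?_
  · simpa using (hp.map (Ideal.Quotient.mk 𝔪)).ne_zero
  · obtain ⟨y, rfl⟩ := Ideal.Quotient.mk_surjective k
    obtain ⟨n, r, hr⟩ := IsLocalization.Away.surj (p : R) y
    refine ⟨r, n, ?_⟩
    rw [map_natCast] at hr
    rw [RingHom.comp_apply, ← hr, map_mul, map_pow, map_natCast]
end
end
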